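/- arXiv:2509.10991 — 7 statements merged into one kernel-verified Lean document; each statement's English description precedes it below -/
import Mathlib

section
/- Let q and d be positive natural numbers and let F, G : SimpleGraph (Fin q) be simple graphs on q vertices (with decidable adjacency). For an invertible T : GL (Fin q) ℂ and a graph H : SimpleGraph (Fin q), define Φ_T(H) to be the pair consisting of (1) the tuple, indexed by n ∈ {1,…,d}, of transformed equality tensors, namely the function sending a : Fin n → Fin q to ∑ b : Fin q, ∏ j, T (a j) b, and (2) the transformed adjacency matrix (↑(T⁻¹))ᵀ * (H.adjMatrix ℂ) * ↑(T⁻¹); these live in the product space (Π n ∈ {1,…,d}, ((Fin n → Fin q) → ℂ)) × Matrix (Fin q) (Fin q) ℂ with its standard topology. Then hom(X, F) = hom(X, G) for every finite simple graph X of maximum degree at most d, if and only if the topological closures of { Φ_T(F) | T : GL (Fin q) ℂ } and { Φ_T(G) | T : GL (Fin q) ℂ } have a common point. (Paper's Corollary cor:bounded_orbit_cl: the first characterization of homomorphism indistinguishability over graphs of bounded degree.) -/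
open Matrix

/-- The holographic transform of the tuple of equality tensors of arities
`1, …, d` together with the adjacency matrix of `H`, by `T ∈ GL_q(ℂ)`:
the `n`-th component is `T^{⊗(n+1)}` applied to the equality tensor, and the
matrix component is the covariant action `(T⁻¹)ᵀ ⬝ A_H ⬝ T⁻¹`. -/
noncomputable def holTransform {q d : ℕ} (T : GL (Fin q) ℂ)
    (H : SimpleGraph (Fin q)) [DecidableRel H.Adj] :
    ((n : Fin d) → ((Fin (n.1 + 1) → Fin q) → ℂ)) × Matrix (Fin q) (Fin q) ℂ :=
  (fun n (a : Fin (n.1 + 1) → Fin q) =>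
      ∑ b : Fin q, ∏ j : Fin (n.1 + 1), (T : Matrix (Fin q) (Fin q) ℂ) (a j) b,
    ((T⁻¹ : GL (Fin q) ℂ) : Matrix (Fin q) (Fin q) ℂ)ᵀ * (H.adjMatrix ℂ) *
      ((T⁻¹ : GL (Fin q) ℂ) : Matrix (Fin q) (Fin q) ℂ))

/-- Continuous functions that are dominated by every Gaussian growth rate. -/
def SubGaussian {ι : Type*} [Fintype ι] (f : (ι → ℝ) → ℝ) : Prop :=
  Continuous f ∧ ∀ ε : ℝ, 0 < ε → ∃ C : ℝ, ∀ W, |f W| ≤ C * Real.exp (ε * (W ⬝ᵥ W))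

namespace SubGaussian

variable {ι : Type*} [Fintype ι]

lemma dotProduct_self_nonneg (W : ι → ℝ) : 0 ≤ W ⬝ᵥ W :=
  Finset.sum_nonneg fun i _ => mul_self_nonneg (W i)

lemma const (c : ℝ) : SubGaussian (fun _ : ι → ℝ => c) :=
  ⟨continuous_const, fun _ hε => ⟨|c|, fun W =>
    le_mul_of_one_le_right (abs_nonneg c)
      (Real.one_le_exp (mul_nonneg hε.le (dotProduct_self_nonneg W)))⟩⟩

lemma add {f g : (ι → ℝ) → ℝ} (hf : SubGaussian f) (hg : SubGaussian g) :
    SubGaussian (fun W => f W + g W) := by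
  refine ⟨hf.1.add hg.1, fun ε hε => ?_⟩
  obtain ⟨C, hC⟩ := hf.2 ε hε
  obtain ⟨D, hD⟩ := hg.2 ε hε
  refine ⟨C + D, fun W => (abs_add_le _ _).trans ?_⟩
  rw [add_mul]
  exact add_le_add (hC W) (hD W)

lemma mul {f g : (ι → ℝ) → ℝ} (hf : SubGaussian f) (hg : SubGaussian g) :
    SubGaussian (fun W => f W * g W) := by
  refine ⟨hf.1.mul hg.1, fun ε hε => ?_⟩
  obtain ⟨C, hC⟩ := hf.2 (ε / 2) (by positivity)
  obtain ⟨D, hD⟩ := hg.2 (ε / 2) (by positivity)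
  refine ⟨C * D, fun W => ?_⟩
  rw [abs_mul]
  calc |f W| * |g W| ≤ _ * _ :=
        mul_le_mul (hC W) (hD W) (abs_nonneg _) ((abs_nonneg _).trans (hC W))
    _ = C * D * (Real.exp (ε / 2 * (W ⬝ᵥ W)) * Real.exp (ε / 2 * (W ⬝ᵥ W))) := by ring
    _ = _ := by rw [← Real.exp_add]; ring_nf

lemma coord (i : ι) : SubGaussian (fun W : ι → ℝ => W i) := by
  refine ⟨continuous_apply i, fun ε hε => ⟨1 + 1 / ε, fun W => ?_⟩⟩
  have h1 : W i * W i ≤ W ⬝ᵥ W :=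
    Finset.single_le_sum (f := fun i => W i * W i) (fun j _ => mul_self_nonneg (W j))
      (Finset.mem_univ i)
  have h2 : |W i| ≤ 1 + W i * W i := by
    rw [abs_le]; constructor <;> nlinarith [sq_nonneg (W i - 1), sq_nonneg (W i + 1)]
  have h3 := Real.add_one_le_exp (ε * (W ⬝ᵥ W))
  have h0 := dotProduct_self_nonneg W
  calc |W i| ≤ 1 + W ⬝ᵥ W := by linarith
    _ ≤ (1 + 1 / ε) * (ε * (W ⬝ᵥ W) + 1) := by
        have : (1 + 1 / ε) * (ε * (W ⬝ᵥ W) + 1) = 1 + W ⬝ᵥ W + ε * (W ⬝ᵥ W) + 1 / ε := by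
          field_simp; ring
        rw [this]; have := mul_nonneg hε.le h0; have : 0 < 1 / ε := by positivity
        linarith
    _ ≤ _ := by gcongr

lemma sum {α : Type*} {f : α → (ι → ℝ) → ℝ} (u : Finset α) (h : ∀ a, SubGaussian (f a)) :
    SubGaussian (fun W => ∑ a ∈ u, f a W) := by
  classical
  induction u using Finset.induction_on with
  | empty => simpa using const 0
  | insert a u ha ih => simpa [Finset.sum_insert ha] using (h a).add ih

lemma prod {α : Type*} {f : α → (ι → ℝ) → ℝ} (u : Finset α) (h : ∀ a, SubGaussian (f a)) :
    SubGaussian (fun W => ∏ a ∈ u, f a W) := by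
  classical
  induction u using Finset.induction_on with
  | empty => simpa using const 1
  | insert a u ha ih => simpa [Finset.prod_insert ha] using (h a).mul ih

lemma pow {f : (ι → ℝ) → ℝ} (h : SubGaussian f) (n : ℕ) : SubGaussian (fun W => f W ^ n) := by
  simpa using prod (Finset.range n) (fun _ => h)

lemma dotProduct (a : ι → ℝ) : SubGaussian (fun W => a ⬝ᵥ W) :=
  sum Finset.univ fun i => (const (a i)).mul (coord i)

lemma continuous_gaussian (s : ℝ) : Continuous fun W : ι → ℝ => Real.exp (-s * (W ⬝ᵥ W)) := by
  unfold _root_.dotProduct; fun_prop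

lemma integrable_gaussian {s : ℝ} (hs : 0 < s) :
    MeasureTheory.Integrable fun W : ι → ℝ => Real.exp (-s * (W ⬝ᵥ W)) := by
  have := MeasureTheory.Integrable.fintype_prod (ι := ι)
    (f := fun _ (x : ℝ) => Real.exp (-s * x ^ 2))
    (μ := fun _ => MeasureTheory.volume)
    (fun _ => integrable_exp_neg_mul_sq hs)
  refine this.congr (Filter.Eventually.of_forall fun W => ?_)
  simp only [_root_.dotProduct, Finset.mul_sum, Real.exp_sum, sq]

lemma bounded_mul_gaussian {f : (ι → ℝ) → ℝ} (hf : SubGaussian f) {s : ℝ} (hs : 0 < s) :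
    ∃ C, ∀ W, |f W * Real.exp (-s * (W ⬝ᵥ W))| ≤ C := by
  obtain ⟨C, hC⟩ := hf.2 s hs
  refine ⟨C, fun W => ?_⟩
  rw [abs_mul, Real.abs_exp]
  calc _ ≤ C * Real.exp (s * (W ⬝ᵥ W)) * Real.exp (-s * (W ⬝ᵥ W)) := by gcongr; exact hC W
    _ = C := by rw [mul_assoc, ← Real.exp_add]; simp

lemma integrable_mul_gaussian {f : (ι → ℝ) → ℝ} (hf : SubGaussian f) {s : ℝ} (hs : 0 < s) :
    MeasureTheory.Integrable fun W => f W * Real.exp (-s * (W ⬝ᵥ W)) := by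
  obtain ⟨C, hC⟩ := hf.bounded_mul_gaussian (half_pos hs)
  refine ((integrable_gaussian (ι := ι) (half_pos hs)).const_mul C).mono'
    (hf.1.mul (continuous_gaussian s)).aestronglyMeasurable
    (Filter.Eventually.of_forall fun W => ?_)
  have : Real.exp (-s * (W ⬝ᵥ W)) =
      Real.exp (-(s / 2) * (W ⬝ᵥ W)) * Real.exp (-(s / 2) * (W ⬝ᵥ W)) := by
    rw [← Real.exp_add]; ring_nf
  rw [this, ← mul_assoc, Real.norm_eq_abs, abs_mul, Real.abs_exp]
  gcongr
  exact hC W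

end SubGaussian

open MeasureTheory in
/-- Gaussian integration by parts for a product of linear forms. -/
lemma integral_dotProduct_mul_prod_gaussian {ι η : Type*} [Fintype ι] [DecidableEq η]
    {s : ℝ} (hs : 0 < s) (a : ι → ℝ) (f : η → ι → ℝ) (u : Finset η) :
    ∫ W : ι → ℝ, (a ⬝ᵥ W) * (∏ h ∈ u, f h ⬝ᵥ W) * Real.exp (-s * (W ⬝ᵥ W)) =
      (2 * s)⁻¹ * ∑ h ∈ u, (f h ⬝ᵥ a) *
        ∫ W : ι → ℝ, (∏ k ∈ u.erase h, f k ⬝ᵥ W) * Real.exp (-s * (W ⬝ᵥ W)) := by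
  have hlin (b W : ι → ℝ) : HasFDerivAt (fun W : ι → ℝ => b ⬝ᵥ W)
      (∑ i, b i • ContinuousLinearMap.proj (R := ℝ) (φ := fun _ : ι => ℝ) i) W := by
    unfold dotProduct
    exact HasFDerivAt.fun_sum fun i _ => (hasFDerivAt_apply i W).const_mul (b i)
  have hprod (W : ι → ℝ) := HasFDerivAt.finsetProd (u := u) (x := W)
    (g := fun h W => f h ⬝ᵥ W) (fun h _ => hlin (f h) W)
  have hgauss (W : ι → ℝ) : HasFDerivAt (fun W : ι → ℝ => Real.exp (-s * (W ⬝ᵥ W)))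
      (Real.exp (-s * (W ⬝ᵥ W)) • (-s) • ∑ i,
        ((W i • ContinuousLinearMap.proj (R := ℝ) (φ := fun _ : ι => ℝ) i) +
          (W i • ContinuousLinearMap.proj (R := ℝ) (φ := fun _ : ι => ℝ) i))) W := by
    refine HasFDerivAt.exp (HasFDerivAt.const_mul ?_ _)
    unfold dotProduct
    exact HasFDerivAt.fun_sum fun i _ => (hasFDerivAt_apply i W).mul (hasFDerivAt_apply i W)
  have hP : SubGaussian fun W : ι → ℝ => ∏ h ∈ u, f h ⬝ᵥ W :=
    SubGaussian.prod u fun h => SubGaussian.dotProduct (f h)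
  have hder1 (W : ι → ℝ) : fderiv ℝ (fun W : ι → ℝ => ∏ h ∈ u, f h ⬝ᵥ W) W a =
      ∑ h ∈ u, (f h ⬝ᵥ a) * ∏ k ∈ u.erase h, f k ⬝ᵥ W := by
    rw [(hprod W).fderiv]
    simp [dotProduct, mul_comm]
  have hder2 (W : ι → ℝ) : fderiv ℝ (fun W : ι → ℝ => Real.exp (-s * (W ⬝ᵥ W))) W a =
      (-(2 * s)) * ((a ⬝ᵥ W) * Real.exp (-s * (W ⬝ᵥ W))) := by
    rw [(hgauss W).fderiv]
    simp [dotProduct, Finset.sum_add_distrib, mul_comm]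
    ring
  have key := integral_mul_fderiv_eq_neg_fderiv_mul_of_integrable (μ := volume) (v := a)
    (f := fun W : ι → ℝ => ∏ h ∈ u, f h ⬝ᵥ W)
    (g := fun W : ι → ℝ => Real.exp (-s * (W ⬝ᵥ W)))
    (by
      simp only [hder1]
      exact (SubGaussian.sum u fun h => (SubGaussian.const _).mul
        (SubGaussian.prod _ fun k => SubGaussian.dotProduct (f k))).integrable_mul_gaussian hs)
    (by
      simp only [hder2]
      have := ((SubGaussian.const (-(2 * s))).mul
        (hP.mul (SubGaussian.dotProduct a))).integrable_mul_gaussian hs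
      refine this.congr (Filter.Eventually.of_forall fun W => ?_)
      ring)
    (hP.integrable_mul_gaussian hs)
    (fun W _ => (hprod W).differentiableAt) (fun W _ => (hgauss W).differentiableAt)
  simp only [hder1, hder2, Finset.sum_mul] at key
  rw [integral_finsetSum] at key
  · simp only [mul_assoc, integral_const_mul] at key
    rw [eq_inv_mul_iff_mul_eq₀ (by positivity), ← integral_const_mul, ← neg_inj, ← key,
      ← integral_neg]
    congr 1; ext W; ring
  · intro h _
    exact ((SubGaussian.const _).mul
        (SubGaussian.prod _ fun k => SubGaussian.dotProduct (f k))).integrable_mul_gaussian hs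

open MeasureTheory in
/-- Two families of functions of subgaussian growth with the same Gaussian moments attain the same
joint values. -/
lemma exists_common_value {ι I : Type*} [Fintype ι] [Fintype I] {g₁ g₂ : I → (ι → ℝ) → ℝ}
    (h₁ : ∀ i, SubGaussian (g₁ i)) (h₂ : ∀ i, SubGaussian (g₂ i))
    (hinteg : ∀ (m : I → ℕ) (s : ℝ), 0 < s →
      ∫ W, (∏ i, g₁ i W ^ m i) * Real.exp (-s * (W ⬝ᵥ W)) =
        ∫ W, (∏ i, g₂ i W ^ m i) * Real.exp (-s * (W ⬝ᵥ W)))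
    (L : ι → ℝ) : ∃ R, ∀ i, g₂ i R = g₁ i L := by
  classical
  let ρ : (ι → ℝ) → ℝ := fun W => Real.exp (-1 * (W ⬝ᵥ W))
  have hρc : Continuous ρ := SubGaussian.continuous_gaussian 1
  have hρpos (W) : 0 < ρ W := Real.exp_pos _
  have hρint : Integrable ρ := SubGaussian.integrable_gaussian one_pos
  let v (g : I → (ι → ℝ) → ℝ) (j : Option I) (W : ι → ℝ) : ℝ := j.elim 1 (fun i => g i W) * ρ W
  have hsub {g : I → (ι → ℝ) → ℝ} (h : ∀ i, SubGaussian (g i)) (j : Option I) :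
      SubGaussian fun W => j.elim 1 (fun i => g i W) := by
    cases j with
    | none => exact SubGaussian.const 1
    | some i => exact h i
  have hvc {g : I → (ι → ℝ) → ℝ} (h : ∀ i, SubGaussian (g i)) (j : Option I) :
      Continuous (v g j) := (hsub h j).1.mul hρc
  have hvb {g : I → (ι → ℝ) → ℝ} (h : ∀ i, SubGaussian (g i)) (j : Option I) :
      ∃ C, ∀ W, |v g j W| ≤ C := (hsub h j).bounded_mul_gaussian one_pos
  have hmono (g : I → (ι → ℝ) → ℝ) (m : Option I → ℕ) (W) :
      (∏ j, v g j W ^ m j) * ρ W =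
        (∏ i, g i W ^ m (some i)) * Real.exp (-(1 + ∑ j, (m j : ℝ)) * (W ⬝ᵥ W)) := by
    simp only [v, mul_pow, Finset.prod_mul_distrib]
    rw [Fintype.prod_option]
    have : (∏ j, ρ W ^ m j) * ρ W = Real.exp (-(1 + ∑ j, (m j : ℝ)) * (W ⬝ᵥ W)) := by
      simp only [ρ, ← Real.exp_nat_mul, ← Real.exp_sum, ← Real.exp_add]
      rw [← Finset.sum_mul]; ring_nf
    rw [mul_assoc, this]
    simp
  have hmonoint {g : I → (ι → ℝ) → ℝ} (h : ∀ i, SubGaussian (g i)) (m : Option I → ℕ) :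
      Integrable fun W => (∏ j, v g j W ^ m j) * ρ W := by
    simp only [hmono]
    exact (SubGaussian.prod _ fun i => (h i).pow _).integrable_mul_gaussian (by positivity)
  have hpoly (p : MvPolynomial (Option I) ℝ) :
      ∫ W, MvPolynomial.eval (fun j => v g₁ j W) p * ρ W =
        ∫ W, MvPolynomial.eval (fun j => v g₂ j W) p * ρ W := by
    simp only [MvPolynomial.eval_eq', Finset.sum_mul, mul_assoc]
    rw [integral_finsetSum _ fun (m : Option I →₀ ℕ) _ => (hmonoint h₁ m).const_mul _,
      integral_finsetSum _ fun (m : Option I →₀ ℕ) _ => (hmonoint h₂ m).const_mul _]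
    refine Finset.sum_congr rfl fun m _ => ?_
    rw [integral_const_mul, integral_const_mul]
    simp only [hmono]
    rw [hinteg _ _ (by positivity)]
  let c (j : Option I) : ℝ := v g₁ j L
  let D (g : I → (ι → ℝ) → ℝ) (W : ι → ℝ) : ℝ := ∑ j, (v g j W - c j) ^ 2
  have hDc {g : I → (ι → ℝ) → ℝ} (h : ∀ i, SubGaussian (g i)) : Continuous (D g) :=
    continuous_finsetSum _ fun j _ => ((hvc h j).sub continuous_const).pow 2
  have hD0 (g : I → (ι → ℝ) → ℝ) (W) : 0 ≤ D g W := Finset.sum_nonneg fun j _ => sq_nonneg _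
  have hDb {g : I → (ι → ℝ) → ℝ} (h : ∀ i, SubGaussian (g i)) : ∃ M, ∀ W, D g W ≤ M := by
    choose C hC using hvb h
    refine ⟨∑ j, (C j + |c j|) ^ 2, fun W => Finset.sum_le_sum fun j _ => ?_⟩
    refine sq_le_sq' ?_ ?_ <;>
      linarith [abs_le.1 (hC j W), neg_abs_le (c j), le_abs_self (c j), (abs_le.1 (hC j W)).1,
        (abs_le.1 (hC j W)).2]
  by_contra! hno
  have hne (W) : 0 < D g₂ W := by
    refine (hD0 _ W).lt_of_ne fun h0 => ?_
    have h0' := (Finset.sum_eq_zero_iff_of_nonneg fun j _ => sq_nonneg _).1 h0.symm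
    have hz (j) : v g₂ j W = v g₁ j L := by
      have := h0' j (Finset.mem_univ j)
      exact sub_eq_zero.1 (pow_eq_zero_iff two_ne_zero |>.1 this)
    have hρ : ρ W = ρ L := by simpa [v] using hz none
    obtain ⟨i, hi⟩ := hno W
    have := hz (some i)
    simp only [v, Option.elim_some, hρ] at this
    exact hi (mul_right_cancel₀ (hρpos L).ne' this)
  obtain ⟨δ, hδ, hδD⟩ : ∃ δ, 0 < δ ∧ ∀ W, δ ≤ D g₂ W := by
    let K : Set (ι → ℝ) := {W | ρ L / 2 ≤ ρ W}
    have hK : IsCompact K := by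
      refine Metric.isCompact_of_isClosed_isBounded (isClosed_le continuous_const hρc) ?_
      rw [Metric.isBounded_iff_subset_closedBall 0]
      refine ⟨1 - Real.log (ρ L / 2), fun W hW => ?_⟩
      have h1 : Real.log (ρ L / 2) ≤ -1 * (W ⬝ᵥ W) := by
        rw [Real.log_le_iff_le_exp (by have := hρpos L; positivity)]; exact hW
      rw [mem_closedBall_zero_iff]
      have h0 := SubGaussian.dotProduct_self_nonneg W
      refine (pi_norm_le_iff_of_nonneg (by linarith)).2 fun i => ?_
      have h2 : W i * W i ≤ W ⬝ᵥ W :=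
        Finset.single_le_sum (f := fun i => W i * W i) (fun j _ => mul_self_nonneg (W j))
          (Finset.mem_univ i)
      rw [Real.norm_eq_abs, abs_le]
      constructor <;> nlinarith [sq_nonneg (W i - 1), sq_nonneg (W i + 1)]
    have hLK : L ∈ K := by
      have := hρpos L
      change ρ L / 2 ≤ ρ L
      linarith
    obtain ⟨W₀, hW₀, hmin⟩ := hK.exists_isMinOn ⟨L, hLK⟩ (hDc h₂).continuousOn
    refine ⟨min (D g₂ W₀) ((ρ L / 2) ^ 2), lt_min (hne W₀) (by have := hρpos L; positivity),
      fun W => ?_⟩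
    by_cases hW : W ∈ K
    · exact (min_le_left _ _).trans (hmin hW)
    · refine (min_le_right _ _).trans ?_
      have h1 : ρ W < ρ L / 2 := not_le.1 hW
      have h2 : (v g₂ none W - c none) ^ 2 ≤ D g₂ W :=
        Finset.single_le_sum (f := fun j => (v g₂ j W - c j) ^ 2) (fun j _ => sq_nonneg _)
          (Finset.mem_univ none)
      have h3 : v g₂ none W - c none = ρ W - ρ L := by simp [v, c]
      rw [h3] at h2
      nlinarith [hρpos W, hρpos L]
  obtain ⟨M₁, hM₁⟩ := hDb h₁
  obtain ⟨M₂, hM₂⟩ := hDb h₂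
  let M := max M₁ M₂
  have hMδ : δ ≤ M := (hδD L).trans ((hM₂ L).trans (le_max_right _ _))
  have hMpos : 0 < M := hδ.trans_le hMδ
  have hr (g : I → (ι → ℝ) → ℝ) (k : ℕ) (W) :
      (1 - D g W / M) ^ k = MvPolynomial.eval (fun j => v g j W)
        ((1 - MvPolynomial.C M⁻¹ * ∑ j, (MvPolynomial.X j - MvPolynomial.C (c j)) ^ 2) ^ k) := by
    simp [D, div_eq_inv_mul, map_sum]
  have hmom (k : ℕ) : ∫ W, (1 - D g₁ W / M) ^ k * ρ W = ∫ W, (1 - D g₂ W / M) ^ k * ρ W := by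
    simp only [hr]
    exact hpoly _
  have hDL : D g₁ L = 0 := by simp [D, c]
  let U : Set (ι → ℝ) := {W | D g₁ W < δ / 2}
  have hUo : IsOpen U := isOpen_lt (hDc h₁) continuous_const
  have hUpos : 0 < ∫ W in U, ρ W := by
    rw [setIntegral_pos_iff_support_of_nonneg_ae
      (Filter.Eventually.of_forall fun W => (hρpos W).le) hρint.integrableOn]
    have : Function.support ρ = Set.univ := Set.eq_univ_of_forall fun W => (hρpos W).ne'
    rw [this, Set.univ_inter]
    exact hUo.measure_pos _ ⟨L, by simpa [U, hDL] using hδ⟩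
  have h01₁ (W) : 0 ≤ 1 - D g₁ W / M :=
    sub_nonneg.2 ((div_le_one hMpos).2 ((hM₁ W).trans (le_max_left _ _)))
  have h01₂ (W) : 0 ≤ 1 - D g₂ W / M :=
    sub_nonneg.2 ((div_le_one hMpos).2 ((hM₂ W).trans (le_max_right _ _)))
  have hle1 (g) (W) : 1 - D g W / M ≤ 1 := by
    have := div_nonneg (hD0 g W) hMpos.le; linarith
  have hinteg' {g : I → (ι → ℝ) → ℝ} (h : ∀ i, SubGaussian (g i))
      (h0 : ∀ W, 0 ≤ 1 - D g W / M) (k : ℕ) :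
      Integrable fun W => (1 - D g W / M) ^ k * ρ W := by
    refine hρint.mono' ((((continuous_const.sub ((hDc h).div_const M)).pow k).mul
      hρc).aestronglyMeasurable) (Filter.Eventually.of_forall fun W => ?_)
    rw [Real.norm_eq_abs, abs_mul, abs_of_pos (hρpos W), abs_of_nonneg (pow_nonneg (h0 W) k)]
    exact mul_le_of_le_one_left (hρpos W).le (pow_le_one₀ (h0 W) (hle1 g W))
  set x := 1 - δ / 2 / M with hx
  set y := 1 - δ / M with hy
  have hδM : δ / M ≤ 1 := (div_le_one hMpos).2 hMδ
  have hδM0 : 0 < δ / M := div_pos hδ hMpos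
  have hxy : y < x := by rw [hx, hy, div_right_comm]; linarith
  have hy0 : 0 ≤ y := by linarith
  have hx0 : 0 < x := hy0.trans_lt hxy
  have hupper (k : ℕ) : ∫ W, (1 - D g₂ W / M) ^ k * ρ W ≤ y ^ k * ∫ W, ρ W := by
    rw [← integral_const_mul]
    refine integral_mono (hinteg' h₂ h01₂ k) (hρint.const_mul _) fun W => ?_
    have : D g₂ W / M ≥ δ / M := div_le_div_of_nonneg_right (hδD W) hMpos.le
    exact mul_le_mul_of_nonneg_right (pow_le_pow_left₀ (h01₂ W) (by linarith) k) (hρpos W).le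
  have hlower (k : ℕ) : x ^ k * ∫ W in U, ρ W ≤ ∫ W, (1 - D g₁ W / M) ^ k * ρ W := by
    rw [← integral_const_mul]
    refine le_trans (setIntegral_mono_on (hρint.const_mul _).integrableOn
      (hinteg' h₁ h01₁ k).integrableOn hUo.measurableSet fun W hW => ?_)
      (setIntegral_le_integral (hinteg' h₁ h01₁ k) (Filter.Eventually.of_forall fun W =>
        mul_nonneg (pow_nonneg (h01₁ W) k) (hρpos W).le))
    have hW' : D g₁ W < δ / 2 := hW
    have : D g₁ W / M ≤ δ / 2 / M := div_le_div_of_nonneg_right hW'.le hMpos.le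
    exact mul_le_mul_of_nonneg_right (pow_le_pow_left₀ hx0.le (by linarith) k) (hρpos W).le
  have hfinal (k : ℕ) : ∫ W in U, ρ W ≤ (y / x) ^ k * ∫ W, ρ W := by
    have := (hlower k).trans ((hmom k).le.trans (hupper k))
    rw [div_pow, div_mul_eq_mul_div, le_div_iff₀ (pow_pos hx0 k)]
    linarith
  have hlim : Filter.Tendsto (fun k : ℕ => (y / x) ^ k * ∫ W, ρ W) Filter.atTop (nhds 0) := by
    simpa using (tendsto_pow_atTop_nhds_zero_of_lt_one (div_nonneg hy0 hx0.le)
      ((div_lt_one hx0).2 hxy)).mul_const (∫ W, ρ W)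
  exact absurd (ge_of_tendsto' hlim hfinal) (not_le.2 hUpos)

section Diagrams

variable {V : Type} {η : Type} {q : ℕ}

/-- The degree of a vertex in the multigraph with edge list `L`, loops counting twice. -/
def multiDegree [DecidableEq V] (L : List (V × V)) (v : V) : ℕ :=
  L.countP (fun e => e.1 = v) + L.countP (fun e => e.2 = v)

/-- The weighted number of homomorphisms from the multigraph with edge list `L` to `A`. -/
def multiHom [Fintype V] [DecidableEq V] (A : Matrix (Fin q) (Fin q) ℝ) (L : List (V × V)) : ℝ :=
  ∑ φ : V → Fin q, (L.map fun e => A (φ e.1) (φ e.2)).prod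

open Classical in
lemma list_prod_adjMatrix (F : SimpleGraph (Fin q)) [DecidableRel F.Adj] (L : List (V × V))
    (φ : V → Fin q) :
    (L.map fun e => F.adjMatrix ℝ (φ e.1) (φ e.2)).prod =
      if ∀ e ∈ L, F.Adj (φ e.1) (φ e.2) then 1 else 0 := by
  induction L with
  | nil => simp
  | cons e L ih =>
    rw [List.map_cons, List.prod_cons, ih]
    by_cases h : F.Adj (φ e.1) (φ e.2) <;> simp [SimpleGraph.adjMatrix_apply, h]

/-- The simple graph underlying an edge list. -/
def edgeListGraph (L : List (V × V)) : SimpleGraph V :=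
  SimpleGraph.fromRel fun u v => (u, v) ∈ L

variable [DecidableEq V]

lemma edgeListGraph_degree_le (L : List (V × V)) (v : V)
    [Fintype ((edgeListGraph L).neighborSet v)] :
    (edgeListGraph L).degree v ≤ multiDegree L v := by
  classical
  rw [← SimpleGraph.card_neighborFinset_eq_degree]
  have hsub : (edgeListGraph L).neighborFinset v ⊆
      ((L.filter fun e => e.1 = v).map Prod.snd).toFinset ∪
        ((L.filter fun e => e.2 = v).map Prod.fst).toFinset := by
    intro w hw
    rw [SimpleGraph.mem_neighborFinset] at hw
    obtain ⟨-, hw | hw⟩ := hw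
    · simp [hw]
    · simp [hw]
  refine (Finset.card_le_card hsub).trans ((Finset.card_union_le _ _).trans ?_)
  refine (add_le_add (List.toFinset_card_le _) (List.toFinset_card_le _)).trans ?_
  simp [multiDegree, List.countP_eq_length_filter]

/-- Join the vertices `a` and `b` of a multigraph by a path of length two. -/
def addPath (L : List (V × V)) (a b : V) : List (Option V × Option V) :=
  (some a, none) :: (some b, none) :: L.map (Prod.map some some)

lemma multiDegree_addPath_none (L : List (V × V)) (a b : V) :
    multiDegree (addPath L a b) none = 2 := by
  simp [multiDegree, addPath, List.countP_map, Function.comp_def]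

lemma multiDegree_addPath_some (L : List (V × V)) (a b v : V) :
    multiDegree (addPath L a b) (some v) =
      multiDegree L v + (if a = v then 1 else 0) + (if b = v then 1 else 0) := by
  simp [multiDegree, addPath, List.countP_map, Function.comp_def, List.countP_cons]
  ring

variable [Fintype V]

lemma multiHom_adjMatrix_of_loop (F : SimpleGraph (Fin q)) [DecidableRel F.Adj]
    {L : List (V × V)} (h : ∃ e ∈ L, e.1 = e.2) : multiHom (F.adjMatrix ℝ) L = 0 := by
  classical
  refine Finset.sum_eq_zero fun φ _ => ?_
  rw [list_prod_adjMatrix, if_neg]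
  intro hall
  obtain ⟨e, he, h12⟩ := h
  exact (hall e he).ne (by rw [h12])

lemma multiHom_adjMatrix_of_loopless (F : SimpleGraph (Fin q)) [DecidableRel F.Adj]
    {L : List (V × V)} (h : ∀ e ∈ L, e.1 ≠ e.2) :
    multiHom (F.adjMatrix ℝ) L = Nat.card (edgeListGraph L →g F) := by
  classical
  unfold multiHom
  have hsum : ∑ φ : V → Fin q, (L.map fun e => F.adjMatrix ℝ (φ e.1) (φ e.2)).prod =
      Nat.card {φ : V → Fin q // ∀ e ∈ L, F.Adj (φ e.1) (φ e.2)} := by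
    rw [Nat.card_eq_fintype_card, Fintype.card_subtype, ← Finset.sum_boole]
    exact Finset.sum_congr rfl fun φ _ => by rw [list_prod_adjMatrix]; congr
  rw [hsum]
  congr 1
  refine Nat.card_congr ⟨fun φ => ⟨φ.1, ?_⟩, fun f => ⟨f, ?_⟩, fun _ => rfl, fun _ => rfl⟩
  · rintro a b ⟨-, hab | hab⟩
    · exact φ.2 _ hab
    · exact (φ.2 _ hab).symm
  · intro e he
    exact f.map_adj ⟨h e he, Or.inl he⟩

/-- Homomorphism indistinguishability over graphs of maximum degree at most `d` extends to
multigraphs of maximum degree at most `d`. -/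
lemma multiHom_eq_of_hom_eq {d : ℕ} {F G : SimpleGraph (Fin q)} [DecidableRel F.Adj]
    [DecidableRel G.Adj]
    (hFG : ∀ (n : ℕ) (X : SimpleGraph (Fin n)) [DecidableRel X.Adj],
      (∀ v : Fin n, X.degree v ≤ d) → Fintype.card (X →g F) = Fintype.card (X →g G))
    {L : List (V × V)} (hL : ∀ v, multiDegree L v ≤ d) :
    multiHom (F.adjMatrix ℝ) L = multiHom (G.adjMatrix ℝ) L := by
  classical
  by_cases hloop : ∃ e ∈ L, e.1 = e.2
  · rw [multiHom_adjMatrix_of_loop F hloop, multiHom_adjMatrix_of_loop G hloop]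
  · push Not at hloop
    rw [multiHom_adjMatrix_of_loopless F hloop, multiHom_adjMatrix_of_loopless G hloop]
    let i := (edgeListGraph L).overFinIso rfl
    have hcard (K : SimpleGraph (Fin q)) : Nat.card (edgeListGraph L →g K) =
        Nat.card ((edgeListGraph L).overFin rfl →g K) :=
      Nat.card_congr ⟨fun f => f.comp i.symm.toHom, fun f => f.comp i.toHom,
        fun f => by ext; simp, fun f => by ext; simp⟩
    rw [hcard F, hcard G, Nat.card_eq_fintype_card, Nat.card_eq_fintype_card]
    congr 1
    refine hFG _ _ fun v => ?_
    obtain ⟨w, rfl⟩ := i.surjective v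
    rw [i.degree_eq]
    exact (edgeListGraph_degree_le L w).trans (hL w)

/-- The linear form `W ↦ (A * W) b c` on `q × q` matrices. -/
def halfEdge (A : Matrix (Fin q) (Fin q) ℝ) (b c : Fin q) : Fin q × Fin q → ℝ :=
  fun e => if e.2 = c then A b e.1 else 0

lemma halfEdge_dotProduct_halfEdge (A : Matrix (Fin q) (Fin q) ℝ) (b c b' c' : Fin q) :
    halfEdge A b c ⬝ᵥ halfEdge A b' c' = if c = c' then ∑ y, A b y * A b' y else 0 := by
  unfold dotProduct halfEdge
  rw [Fintype.sum_prod_type]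
  split_ifs with h
  · subst h; simp
  · refine Finset.sum_eq_zero fun x _ => Finset.sum_eq_zero fun y _ => ?_
    by_cases hy : y = c
    · have : y ≠ c' := fun h' => h (hy.symm.trans h')
      simp [this]
    · simp [hy]

/-- The polynomial in `W` obtained from a multigraph with edge list `L` and open half-edges `u`,
where the half-edge `h` is attached to the vertex `(H h).1` and carries the form `halfEdge` of
colour `(H h).2`. -/
def diagram (A : Matrix (Fin q) (Fin q) ℝ) (L : List (V × V)) (H : η → V × Fin q) (u : Finset η)
    (W : Fin q × Fin q → ℝ) : ℝ :=
  ∑ φ : V → Fin q, (L.map fun e => A (φ e.1) (φ e.2)).prod *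
    ∏ h ∈ u, halfEdge A (φ (H h).1) (H h).2 ⬝ᵥ W

lemma subGaussian_diagram (A : Matrix (Fin q) (Fin q) ℝ) (L : List (V × V)) (H : η → V × Fin q)
    (u : Finset η) : SubGaussian (diagram A L H u) :=
  SubGaussian.sum _ fun _ => (SubGaussian.const _).mul
    (SubGaussian.prod _ fun _ => SubGaussian.dotProduct _)

lemma diagram_addPath (A : Matrix (Fin q) (Fin q) ℝ) (L : List (V × V)) (H : η → V × Fin q)
    (u : Finset η) (a b : V) (W : Fin q × Fin q → ℝ) :
    diagram A (addPath L a b) (fun k => (some (H k).1, (H k).2)) u W =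
      ∑ φ : V → Fin q, (L.map fun e => A (φ e.1) (φ e.2)).prod *
        ((∑ y, A (φ a) y * A (φ b) y) * ∏ h ∈ u, halfEdge A (φ (H h).1) (H h).2 ⬝ᵥ W) := by
  unfold diagram
  rw [← (Equiv.piOptionEquivProd (β := fun _ : Option V => Fin q)).symm.sum_comp,
    Fintype.sum_prod_type, Finset.sum_comm]
  refine Finset.sum_congr rfl fun φ _ => ?_
  rw [Finset.sum_mul, Finset.mul_sum]
  refine Finset.sum_congr rfl fun y _ => ?_
  simp [addPath, Equiv.piOptionEquivProd, Function.comp_def]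
  ring

open MeasureTheory in
lemma integral_diagram_of_mem [DecidableEq η] (A : Matrix (Fin q) (Fin q) ℝ) (L : List (V × V))
    (H : η → V × Fin q) {u : Finset η} {h₀ : η} (h₀u : h₀ ∈ u) {s : ℝ} (hs : 0 < s) :
    ∫ W, diagram A L H u W * Real.exp (-s * (W ⬝ᵥ W)) =
      (2 * s)⁻¹ * ∑ h ∈ u.erase h₀, if (H h).2 = (H h₀).2 then
        ∫ W, diagram A (addPath L (H h).1 (H h₀).1) (fun k => (some (H k).1, (H k).2))
          ((u.erase h₀).erase h) W * Real.exp (-s * (W ⬝ᵥ W)) else 0 := by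
  have hinteg (φ : V → Fin q) (c : ℝ) (w : Finset η) :
      Integrable fun W : Fin q × Fin q → ℝ =>
        c * ((∏ h ∈ w, halfEdge A (φ (H h).1) (H h).2 ⬝ᵥ W) * Real.exp (-s * (W ⬝ᵥ W))) :=
    ((SubGaussian.prod w fun _ => SubGaussian.dotProduct _).integrable_mul_gaussian hs).const_mul c
  have hL : ∫ W, diagram A L H u W * Real.exp (-s * (W ⬝ᵥ W)) =
      ∑ φ : V → Fin q, (L.map fun e => A (φ e.1) (φ e.2)).prod * ((2 * s)⁻¹ *
        ∑ h ∈ u.erase h₀,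
          (halfEdge A (φ (H h).1) (H h).2 ⬝ᵥ halfEdge A (φ (H h₀).1) (H h₀).2) *
          ∫ W : Fin q × Fin q → ℝ, (∏ k ∈ (u.erase h₀).erase h,
            halfEdge A (φ (H k).1) (H k).2 ⬝ᵥ W) * Real.exp (-s * (W ⬝ᵥ W))) := by
    simp only [diagram, Finset.sum_mul, mul_assoc]
    rw [integral_finsetSum _ fun φ _ => hinteg φ _ u]
    refine Finset.sum_congr rfl fun φ _ => ?_
    rw [integral_const_mul]
    have := integral_dotProduct_mul_prod_gaussian hs (halfEdge A (φ (H h₀).1) (H h₀).2)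
      (fun h => halfEdge A (φ (H h).1) (H h).2) (u.erase h₀)
    have hsplit (W) := Finset.mul_prod_erase u
      (fun h => halfEdge A (φ (H h).1) (H h).2 ⬝ᵥ W) h₀u
    simp only [← hsplit, this]
  rw [hL]
  have hR (h : η) : ∫ W, diagram A (addPath L (H h).1 (H h₀).1) (fun k => (some (H k).1, (H k).2))
          ((u.erase h₀).erase h) W * Real.exp (-s * (W ⬝ᵥ W)) =
      ∑ φ : V → Fin q, (L.map fun e => A (φ e.1) (φ e.2)).prod *
        ((∑ y, A (φ (H h).1) y * A (φ (H h₀).1) y) *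
          ∫ W : Fin q × Fin q → ℝ, (∏ k ∈ (u.erase h₀).erase h,
            halfEdge A (φ (H k).1) (H k).2 ⬝ᵥ W) * Real.exp (-s * (W ⬝ᵥ W))) := by
    simp only [diagram_addPath, Finset.sum_mul (s := (Finset.univ : Finset (V → Fin q)))]
    simp only [← mul_assoc]
    simp only [mul_assoc _ (Finset.prod _ _) (Real.exp _)]
    rw [integral_finsetSum _ fun φ _ => hinteg φ _ _]
    simp only [integral_const_mul]
  simp only [hR, halfEdge_dotProduct_halfEdge, Finset.mul_sum (s := u.erase h₀)]
  rw [Finset.sum_comm]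
  refine Finset.sum_congr rfl fun h _ => ?_
  split_ifs
  · rw [Finset.mul_sum]
    refine Finset.sum_congr rfl fun φ _ => by ring
  · simp

open MeasureTheory in
lemma integral_diagram_eq {d : ℕ} (hd : 2 ≤ d) {A B : Matrix (Fin q) (Fin q) ℝ}
    (hAB : ∀ (V : Type) [Fintype V] [DecidableEq V] (L : List (V × V)),
      (∀ v, multiDegree L v ≤ d) → multiHom A L = multiHom B L)
    [DecidableEq η] {s : ℝ} (hs : 0 < s)
    (L : List (V × V)) (H : η → V × Fin q) (u : Finset η)
    (hdeg : ∀ v, multiDegree L v + (u.filter fun h => (H h).1 = v).card ≤ d) :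
    ∫ W, diagram A L H u W * Real.exp (-s * (W ⬝ᵥ W)) =
      ∫ W, diagram B L H u W * Real.exp (-s * (W ⬝ᵥ W)) := by
  induction hn : u.card using Nat.strong_induction_on generalizing V u with
  | _ n ih =>
  obtain rfl | ⟨h₀, h₀u⟩ := u.eq_empty_or_nonempty
  · have h := hAB V L fun v => by simpa using hdeg v
    simp only [multiHom] at h
    simp [diagram, h]
  · rw [integral_diagram_of_mem A L H h₀u hs, integral_diagram_of_mem B L H h₀u hs]
    congr 1
    refine Finset.sum_congr rfl fun h hh => ?_
    split_ifs
    · refine ih _ ?_ _ _ _ ?_ rfl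
      · rw [← hn]
        exact (Finset.card_erase_le).trans_lt (Finset.card_erase_lt_of_mem h₀u)
      · rintro (_ | v)
        · simpa [multiDegree_addPath_none] using hd
        · refine le_trans (le_of_eq ?_) (hdeg v)
          rw [multiDegree_addPath_some, Finset.card_filter, Finset.card_filter,
            ← Finset.add_sum_erase u _ h₀u, ← Finset.add_sum_erase (u.erase h₀) _ hh]
          simp only [Option.some.injEq]
          ring
    · rfl

end Diagrams

section DiagramPairs

variable {q d : ℕ} {A B : Matrix (Fin q) (Fin q) ℝ}

/-- The pair of polynomials obtained by evaluating one diagram of maximum degree at most `d` at two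
matrices. -/
def IsDiagramPair (d : ℕ) (A B : Matrix (Fin q) (Fin q) ℝ) (f g : (Fin q × Fin q → ℝ) → ℝ) :
    Prop :=
  ∃ (V : Type) (_ : Fintype V) (_ : DecidableEq V) (η : Type) (L : List (V × V))
    (H : η → V × Fin q) (u : Finset η),
    (∀ v, multiDegree L v + (u.filter fun h => (H h).1 = v).card ≤ d) ∧
      f = diagram A L H u ∧ g = diagram B L H u

namespace IsDiagramPair

lemma one : IsDiagramPair d A B 1 1 := by
  refine ⟨Empty, inferInstance, inferInstance, Empty, [], Empty.elim, ∅, fun v => v.elim,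
    ?_, ?_⟩ <;>
  · ext W; simp [diagram]

lemma diagram_mul {V₁ V₂ η₁ η₂ : Type} [Fintype V₁] [Fintype V₂] [DecidableEq V₁] [DecidableEq V₂]
    (A : Matrix (Fin q) (Fin q) ℝ) (L₁ : List (V₁ × V₁)) (L₂ : List (V₂ × V₂))
    (H₁ : η₁ → V₁ × Fin q) (H₂ : η₂ → V₂ × Fin q) (u₁ : Finset η₁) (u₂ : Finset η₂) :
    diagram A L₁ H₁ u₁ * diagram A L₂ H₂ u₂ =
      diagram A (L₁.map (Prod.map Sum.inl Sum.inl) ++ L₂.map (Prod.map Sum.inr Sum.inr))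
        (Sum.elim (Prod.map Sum.inl id ∘ H₁) (Prod.map Sum.inr id ∘ H₂)) (u₁.disjSum u₂) := by
  ext W
  simp only [Pi.mul_apply, diagram]
  rw [← (Equiv.sumArrowEquivProdArrow V₁ V₂ (Fin q)).symm.sum_comp, Fintype.sum_prod_type,
    Finset.sum_mul_sum]
  refine Finset.sum_congr rfl fun φ _ => Finset.sum_congr rfl fun ψ _ => ?_
  simp [Finset.prod_disjSum, Equiv.sumArrowEquivProdArrow, Function.comp_def]
  ring

lemma mul {f₁ g₁ f₂ g₂ : (Fin q × Fin q → ℝ) → ℝ} (h₁ : IsDiagramPair d A B f₁ g₁)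
    (h₂ : IsDiagramPair d A B f₂ g₂) : IsDiagramPair d A B (f₁ * f₂) (g₁ * g₂) := by
  obtain ⟨V₁, _, _, η₁, L₁, H₁, u₁, hdeg₁, rfl, rfl⟩ := h₁
  obtain ⟨V₂, _, _, η₂, L₂, H₂, u₂, hdeg₂, rfl, rfl⟩ := h₂
  refine ⟨V₁ ⊕ V₂, inferInstance, inferInstance, η₁ ⊕ η₂, _, _, _, ?_,
    diagram_mul A L₁ L₂ H₁ H₂ u₁ u₂, diagram_mul B L₁ L₂ H₁ H₂ u₁ u₂⟩
  rintro (v | v)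
  · refine le_trans (le_of_eq ?_) (hdeg₁ v)
    rw [Finset.card_filter, Finset.card_filter, Finset.sum_disjSum]
    simp [multiDegree, List.countP_map, Function.comp_def]
  · refine le_trans (le_of_eq ?_) (hdeg₂ v)
    rw [Finset.card_filter, Finset.card_filter, Finset.sum_disjSum]
    simp [multiDegree, List.countP_map, Function.comp_def]

lemma pow {f g : (Fin q × Fin q → ℝ) → ℝ} (h : IsDiagramPair d A B f g) (n : ℕ) :
    IsDiagramPair d A B (f ^ n) (g ^ n) := by
  induction n with
  | zero => simpa using one
  | succ n ih => simpa [pow_succ] using ih.mul h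

lemma prod {α : Type*} {f g : α → (Fin q × Fin q → ℝ) → ℝ} (w : Finset α)
    (h : ∀ a, IsDiagramPair d A B (f a) (g a)) :
    IsDiagramPair d A B (∏ a ∈ w, f a) (∏ a ∈ w, g a) := by
  classical
  induction w using Finset.induction_on with
  | empty => simpa using one
  | insert a w ha ih => simpa [Finset.prod_insert ha] using (h a).mul ih

lemma subGaussian_left {f g : (Fin q × Fin q → ℝ) → ℝ} (h : IsDiagramPair d A B f g) :
    SubGaussian f := by
  obtain ⟨V, _, _, η, L, H, u, -, rfl, -⟩ := h
  exact subGaussian_diagram A L H u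

lemma subGaussian_right {f g : (Fin q × Fin q → ℝ) → ℝ} (h : IsDiagramPair d A B f g) :
    SubGaussian g := by
  obtain ⟨V, _, _, η, L, H, u, -, -, rfl⟩ := h
  exact subGaussian_diagram B L H u

lemma star {n : ℕ} (hn : n ≤ d) (i : Fin n → Fin q) :
    IsDiagramPair d A B (fun W => ∑ b, ∏ j, halfEdge A b (i j) ⬝ᵥ W)
      (fun W => ∑ b, ∏ j, halfEdge B b (i j) ⬝ᵥ W) := by
  refine ⟨Unit, inferInstance, inferInstance, Fin n, [], fun j => ((), i j), Finset.univ,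
    fun v => by simpa [multiDegree] using hn, ?_, ?_⟩ <;>
  · ext W
    unfold diagram
    rw [← (Equiv.funUnique Unit (Fin q)).symm.sum_comp]
    simp

lemma edge (hd : 2 ≤ d) (i j : Fin q) :
    IsDiagramPair d A B
      (fun W => ∑ b, ∑ c, A b c * ((halfEdge A b i ⬝ᵥ W) * (halfEdge A c j ⬝ᵥ W)))
      (fun W => ∑ b, ∑ c, B b c * ((halfEdge B b i ⬝ᵥ W) * (halfEdge B c j ⬝ᵥ W))) := by
  refine ⟨Bool, inferInstance, inferInstance, Bool, [(false, true)],
    fun h => (h, if h then j else i), Finset.univ, fun v => ?_, ?_, ?_⟩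
  · refine le_trans (le_of_eq ?_) hd
    cases v <;> simp [multiDegree, Finset.card_filter]
  all_goals
    ext W
    unfold diagram
    rw [← (Equiv.boolArrowEquivProd (Fin q)).symm.sum_comp, Fintype.sum_prod_type]
    simp [mul_comm]

end IsDiagramPair

lemma halfEdge_dotProduct (A : Matrix (Fin q) (Fin q) ℝ) (b c : Fin q) (W : Fin q × Fin q → ℝ) :
    halfEdge A b c ⬝ᵥ W = (A * Matrix.of fun x y => W (x, y)) b c := by
  unfold dotProduct halfEdge
  rw [Fintype.sum_prod_type]
  simp [Matrix.mul_apply]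

/-- If the multigraphs of maximum degree at most `d` do not distinguish `A` and `B`, then every
value attained by the elementary diagrams of `A` is attained by those of `B`. -/
lemma exists_mul_eq_of_multiHom_eq (hd : 2 ≤ d)
    (hAB : ∀ (V : Type) [Fintype V] [DecidableEq V] (L : List (V × V)),
      (∀ v, multiDegree L v ≤ d) → multiHom A L = multiHom B L)
    (S : Matrix (Fin q) (Fin q) ℝ) :
    ∃ R : Matrix (Fin q) (Fin q) ℝ,
      (∀ n ≤ d, ∀ i : Fin n → Fin q,
        ∑ b, ∏ j, (B * R) b (i j) = ∑ b, ∏ j, (A * S) b (i j)) ∧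
      (B * R)ᵀ * B * (B * R) = (A * S)ᵀ * A * (A * S) := by
  classical
  let I := (Σ n : Fin (d + 1), (Fin n → Fin q)) ⊕ (Fin q × Fin q)
  let g (C : Matrix (Fin q) (Fin q) ℝ) : I → (Fin q × Fin q → ℝ) → ℝ := Sum.elim
    (fun i W => ∑ b, ∏ j, halfEdge C b (i.2 j) ⬝ᵥ W)
    (fun i W => ∑ b, ∑ c, C b c * ((halfEdge C b i.1 ⬝ᵥ W) * (halfEdge C c i.2 ⬝ᵥ W)))
  have hg (i : I) : IsDiagramPair d A B (g A i) (g B i) := by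
    rcases i with ⟨n, i⟩ | ⟨i, j⟩
    · exact IsDiagramPair.star (Nat.lt_succ_iff.1 n.2) i
    · exact IsDiagramPair.edge hd i j
  obtain ⟨R, hR⟩ := exists_common_value (fun i => (hg i).subGaussian_left)
    (fun i => (hg i).subGaussian_right)
    (fun m s hs => by
      obtain ⟨V, _, _, η, L, H, u, hdeg, h₁, h₂⟩ :=
        IsDiagramPair.prod Finset.univ fun i => (hg i).pow (m i)
      have h₁' (W) := congrFun h₁ W
      have h₂' (W) := congrFun h₂ W
      simp only [Finset.prod_apply, Pi.pow_apply] at h₁' h₂'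
      simp only [h₁', h₂']
      exact integral_diagram_eq hd hAB hs L H u hdeg)
    (fun e => S e.1 e.2)
  have hform (C N : Matrix (Fin q) (Fin q) ℝ) (i j : Fin q) :
      (Nᵀ * C * N) i j = ∑ b, ∑ c, C b c * (N b i * N c j) := by
    simp only [Matrix.mul_apply, Matrix.transpose_apply, Finset.sum_mul]
    rw [Finset.sum_comm]
    exact Finset.sum_congr rfl fun b _ => Finset.sum_congr rfl fun c _ => by ring
  have hS : Matrix.of (fun x y => S x y) = S := rfl
  refine ⟨Matrix.of fun x y => R (x, y), fun n hn i => ?_, ?_⟩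
  · simpa [g, halfEdge_dotProduct, hS] using hR (Sum.inl ⟨⟨n, Nat.lt_succ_of_le hn⟩, i⟩)
  · ext i j
    rw [hform, hform]
    simpa [g, halfEdge_dotProduct, hS] using hR (Sum.inr (i, j))

end DiagramPairs

section LinearAlgebra

variable {q : ℕ}

/-- A real symmetric matrix has an orthogonal projection onto its range, and the projection factors
through the matrix. -/
lemma exists_range_projection {A : Matrix (Fin q) (Fin q) ℝ} (hA : A.IsHermitian) :
    ∃ P S : Matrix (Fin q) (Fin q) ℝ, A * S = P ∧ Pᵀ = P ∧ P * P = P ∧ P * A = A ∧ A * P = A := by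
  let U : Matrix (Fin q) (Fin q) ℝ := hA.eigenvectorUnitary
  let D : Matrix (Fin q) (Fin q) ℝ := Matrix.diagonal hA.eigenvalues
  let E : Matrix (Fin q) (Fin q) ℝ := Matrix.diagonal fun i => (hA.eigenvalues i)⁻¹
  have hU : Uᵀ * U = 1 := by
    have := Matrix.mem_unitaryGroup_iff'.1 hA.eigenvectorUnitary.2
    simpa [Matrix.star_eq_conjTranspose, Matrix.conjTranspose_eq_transpose_of_trivial] using this
  have hAD : A = U * D * Uᵀ := by
    have := hA.spectral_theorem
    simpa [Unitary.conjStarAlgAut_apply, Matrix.star_eq_conjTranspose,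
      Matrix.conjTranspose_eq_transpose_of_trivial, Function.comp_def, U, D] using this
  have hmul (X Y : Matrix (Fin q) (Fin q) ℝ) :
      (U * X * Uᵀ) * (U * Y * Uᵀ) = U * (X * Y) * Uᵀ := by
    calc _ = U * X * (Uᵀ * U) * Y * Uᵀ := by simp only [Matrix.mul_assoc]
      _ = _ := by rw [hU]; simp only [Matrix.mul_assoc, Matrix.mul_one]
  have hDE : (D * E) * (D * E) = D * E := by
    simp only [D, E, Matrix.diagonal_mul_diagonal]
    congr 1; ext i
    by_cases h : hA.eigenvalues i = 0 <;> simp [h]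
  have hDED : (D * E) * D = D := by
    simp only [D, E, Matrix.diagonal_mul_diagonal]
    congr 1; ext i
    by_cases h : hA.eigenvalues i = 0 <;> simp [h]
  have hDDE : D * (D * E) = D := by
    simp only [D, E, Matrix.diagonal_mul_diagonal]
    congr 1; ext i
    by_cases h : hA.eigenvalues i = 0 <;> simp [h]
  refine ⟨U * (D * E) * Uᵀ, U * E * Uᵀ, ?_, ?_, ?_, ?_, ?_⟩
  · rw [hAD, hmul]
  · simp [D, E, Matrix.transpose_mul, Matrix.mul_assoc]
  · rw [hmul, hDE]
  · rw [hAD, hmul, hDED]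
  · rw [hAD, hmul, hDDE]

/-- A partial isometry extends to an orthogonal matrix. -/
lemma exists_orthogonal_mul_eq {M P : Matrix (Fin q) (Fin q) ℝ} (hM : Mᵀ * M = P)
    (hPP : P * P = P) : ∃ O : Matrix (Fin q) (Fin q) ℝ, Oᵀ * O = 1 ∧ O * P = M := by
  have hPt : Pᵀ = P := by rw [← hM]; simp
  have hMP : M * P = M := by
    have : (M * P - M)ᴴ * (M * P - M) = 0 := by
      rw [Matrix.conjTranspose_eq_transpose_of_trivial, Matrix.transpose_sub,
        Matrix.transpose_mul, hPt]
      calc (P * Mᵀ - Mᵀ) * (M * P - M)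
          = P * (Mᵀ * M) * P - P * (Mᵀ * M) - (Mᵀ * M) * P + Mᵀ * M := by noncomm_ring
        _ = 0 := by simp [hM, hPP]
    exact sub_eq_zero.1 (Matrix.conjTranspose_mul_self_eq_zero.1 this)
  let E := EuclideanSpace ℝ (Fin q)
  let m : E →ₗ[ℝ] E := Matrix.toEuclideanLin M
  let p : E →ₗ[ℝ] E := Matrix.toEuclideanLin P
  have hinner (N : Matrix (Fin q) (Fin q) ℝ) (x : E) :
      ‖Matrix.toEuclideanLin N x‖ ^ 2 = x.ofLp ⬝ᵥ ((Nᵀ * N) *ᵥ x.ofLp) := by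
    rw [EuclideanSpace.real_norm_sq_eq, ← Matrix.mulVec_mulVec, Matrix.dotProduct_mulVec,
      Matrix.vecMul_transpose]
    simp [dotProduct, sq, Matrix.toEuclideanLin]
  have hnorm (x : E) : ‖m x‖ = ‖p x‖ := by
    have : ‖m x‖ ^ 2 = ‖p x‖ ^ 2 := by
      rw [hinner, hinner, hM, hPt, hPP]
    exact (sq_eq_sq₀ (norm_nonneg _) (norm_nonneg _)).1 this
  have hcomp (N N' : Matrix (Fin q) (Fin q) ℝ) (x : E) : Matrix.toEuclideanLin (N * N') x =
      Matrix.toEuclideanLin N (Matrix.toEuclideanLin N' x) := by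
    simp [Matrix.toLpLin_apply, Matrix.mulVec_mulVec]
  have hpp (x : E) : p (p x) = p x := by
    change toEuclideanLin P (toEuclideanLin P x) = toEuclideanLin P x
    rw [← hcomp, hPP]
  have hmp (x : E) : m (p x) = m x := by
    change toEuclideanLin M (toEuclideanLin P x) = toEuclideanLin M x
    rw [← hcomp, hMP]
  let l : LinearMap.range p →ₗᵢ[ℝ] E :=
    ⟨m.comp (LinearMap.range p).subtype, by
      rintro ⟨_, x, rfl⟩
      change ‖m (p x)‖ = ‖p x‖
      rw [hnorm, hpp]⟩
  let o : E →ₗᵢ[ℝ] E := l.extend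
  let O : Matrix (Fin q) (Fin q) ℝ := Matrix.toEuclideanLin.symm o.toLinearMap
  have hO (x : E) : Matrix.toEuclideanLin O x = o x := by simp [O]
  have hop (x : E) : o (p x) = m x := by
    rw [← hmp]
    exact LinearIsometry.extend_apply l ⟨p x, x, rfl⟩
  refine ⟨O, ?_, ?_⟩
  · have hcol (i k : Fin q) : O k i = o (EuclideanSpace.single i 1) k := by
      rw [← hO]; simp [Matrix.toLpLin_apply]
    ext i j
    have := o.inner_map_map (EuclideanSpace.single j (1 : ℝ)) (EuclideanSpace.single i (1 : ℝ))
    rw [PiLp.inner_apply, EuclideanSpace.inner_single_left] at this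
    rw [Matrix.mul_apply, Matrix.one_apply]
    simp only [Matrix.transpose_apply, hcol]
    simpa [Pi.single_apply, eq_comm] using this
  · apply Matrix.toEuclideanLin.injective
    ext1 x
    exact (hcomp O P x).trans ((hO _).trans (hop x))

/-- If a compression of `C` to a projection preserves the Hilbert–Schmidt norm, it is `C`. -/
lemma eq_of_compression {A C P : Matrix (Fin q) (Fin q) ℝ} (hA : Aᵀ = A) (hC : Cᵀ = C)
    (hPA : P * A = A) (hAP : A * P = A) (hPCP : P * C * P = A)
    (htr : (C * C).trace = (A * A).trace) : C = A := by
  have h1 : (C * A).trace = (A * A).trace := by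
    calc (C * A).trace = (C * (P * A * P)).trace := by rw [hPA, hAP]
      _ = ((C * P * A) * P).trace := by simp only [Matrix.mul_assoc]
      _ = (P * (C * P * A)).trace := Matrix.trace_mul_comm _ _
      _ = (P * C * P * A).trace := by simp only [Matrix.mul_assoc]
      _ = (A * A).trace := by rw [hPCP]
  have h2 : (A * C).trace = (A * A).trace := by rw [Matrix.trace_mul_comm, h1]
  refine sub_eq_zero.1 (Matrix.trace_conjTranspose_mul_self_eq_zero_iff.1 ?_)
  rw [Matrix.conjTranspose_eq_transpose_of_trivial, Matrix.transpose_sub, hA, hC]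
  simp [Matrix.sub_mul, Matrix.mul_sub, Matrix.trace_sub, h1, h2, htr]

end LinearAlgebra

section OrbitInvariants

variable {q d : ℕ}

/-- The contraction of a vertex of degree at most `d` is a continuous function of the equality
tensors of arities `1, …, d`. -/
lemma exists_continuous_vertex {κ : Type*} [Fintype κ] (hκ : Fintype.card κ ≤ d) :
    ∃ τ : ((n : Fin d) → ((Fin (n.1 + 1) → Fin q) → ℂ)) → (κ → Fin q) → ℂ,
      (∀ a, Continuous fun t => τ t a) ∧
      ∀ (T : Matrix (Fin q) (Fin q) ℂ) (a : κ → Fin q),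
        τ (fun _ a => ∑ b, ∏ j, T (a j) b) a = ∑ b, ∏ h, T (a h) b := by
  rcases hn : Fintype.card κ with _ | n
  · have := Fintype.card_eq_zero_iff.1 hn
    exact ⟨fun _ _ => q, fun _ => continuous_const, by simp⟩
  · let e : Fin (n + 1) ≃ κ := (Fintype.equivFinOfCardEq hn).symm
    have hnd : n < d := by omega
    refine ⟨fun t a => t ⟨n, hnd⟩ (a ∘ e), fun a => by fun_prop, fun T a => ?_⟩
    exact Finset.sum_congr rfl fun b _ => e.prod_comp fun h => T (a h) b

lemma sum_prod_adjMatrix {m : ℕ} (X : SimpleGraph (Fin m)) [DecidableRel X.Adj]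
    (H : SimpleGraph (Fin q)) [DecidableRel H.Adj] :
    ∑ φ : Fin m → Fin q, ∏ e : {e : Fin m × Fin m // X.Adj e.1 e.2 ∧ e.1 < e.2},
      H.adjMatrix ℂ (φ e.1.1) (φ e.1.2) = Fintype.card (X →g H) := by
  classical
  have hprod (φ : Fin m → Fin q) :
      ∏ e : {e : Fin m × Fin m // X.Adj e.1 e.2 ∧ e.1 < e.2},
        H.adjMatrix ℂ (φ e.1.1) (φ e.1.2) =
          if ∀ u v, X.Adj u v → H.Adj (φ u) (φ v) then 1 else 0 := by
    simp only [SimpleGraph.adjMatrix_apply, Finset.prod_ite_zero, Finset.prod_const_one]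
    congr 1
    refine propext ⟨fun h u v huv => ?_, fun h e _ => h _ _ e.2.1⟩
    rcases lt_or_gt_of_ne huv.ne with huv' | huv'
    · exact h ⟨(u, v), huv, huv'⟩ (Finset.mem_univ _)
    · exact (h ⟨(v, u), huv.symm, huv'⟩ (Finset.mem_univ _)).symm
  simp only [hprod, Finset.sum_boole]
  rw [← Fintype.card_subtype]
  congr 1
  exact Fintype.card_congr ⟨fun φ => ⟨φ.1, fun {u v} => φ.2 u v⟩,
    fun φ => ⟨φ, fun _ _ => φ.map_rel⟩, fun _ => rfl, fun _ => rfl⟩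

/-- Contracting the tensor network with edges `E` whose half-edges are attached to the vertices
by `s`. -/
lemma sum_contraction {V E : Type*} [Fintype V] [DecidableEq V] [Fintype E] [DecidableEq E]
    (s : E × Bool → V) (T C : Matrix (Fin q) (Fin q) ℂ) :
    ∑ a : E → Bool → Fin q,
      (∏ v, ∑ b, ∏ h : {h // s h = v}, T (a h.1.1 h.1.2) b) * ∏ e, C (a e false) (a e true) =
    ∑ φ : V → Fin q, ∏ e, (Tᵀ * C * T) (φ (s (e, false))) (φ (s (e, true))) := by
  have hvert (a : E → Bool → Fin q) :
      ∏ v, ∑ b, ∏ h : {h // s h = v}, T (a h.1.1 h.1.2) b =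
        ∑ φ : V → Fin q,
          ∏ e, T (a e false) (φ (s (e, false))) * T (a e true) (φ (s (e, true))) := by
    rw [Finset.prod_univ_sum, Fintype.piFinset_univ]
    refine Finset.sum_congr rfl fun φ _ => ?_
    calc _ = ∏ v, ∏ h : {h // s h = v}, T (a h.1.1 h.1.2) (φ (s h.1)) :=
          Finset.prod_congr rfl fun v _ => Finset.prod_congr rfl fun h _ => by rw [h.2]
      _ = ∏ h, T (a h.1 h.2) (φ (s h)) :=
          Fintype.prod_fiberwise s fun h => T (a h.1 h.2) (φ (s h))
      _ = _ := by rw [Fintype.prod_prod_type]; simp [mul_comm]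
  have hedge (i j : Fin q) :
      (Tᵀ * C * T) i j =
        ∑ x : Bool → Fin q, T (x false) i * T (x true) j * C (x false) (x true) := by
    rw [← (Equiv.boolArrowEquivProd (Fin q)).symm.sum_comp, Fintype.sum_prod_type, Finset.sum_comm]
    simp only [Matrix.mul_apply, Matrix.transpose_apply, Finset.sum_mul]
    exact Finset.sum_congr rfl fun b _ => Finset.sum_congr rfl fun c _ => by simp; ring
  simp only [hvert, hedge, Finset.sum_mul]
  rw [Finset.sum_comm]
  refine Finset.sum_congr rfl fun φ _ => ?_
  rw [Finset.prod_univ_sum, Fintype.piFinset_univ]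
  simp only [Finset.prod_mul_distrib]

/-- Homomorphism counts from a graph of maximum degree at most `d` are the values of a continuous
function on the orbits of transformed signatures. -/
lemma exists_continuous_hom_count {m : ℕ} (X : SimpleGraph (Fin m)) [DecidableRel X.Adj]
    (hX : ∀ v, X.degree v ≤ d) :
    ∃ Ψ : ((n : Fin d) → ((Fin (n.1 + 1) → Fin q) → ℂ)) × Matrix (Fin q) (Fin q) ℂ → ℂ,
      Continuous Ψ ∧ ∀ (H : SimpleGraph (Fin q)) [DecidableRel H.Adj] (T : GL (Fin q) ℂ),
        Ψ (holTransform T H) = Fintype.card (X →g H) := by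
  classical
  let E := {e : Fin m × Fin m // X.Adj e.1 e.2 ∧ e.1 < e.2}
  let s : E × Bool → Fin m := fun h => if h.2 then h.1.1.2 else h.1.1.1
  have hs (v : Fin m) : Fintype.card {h // s h = v} ≤ d := by
    refine le_trans ?_ (hX v)
    rw [← SimpleGraph.card_neighborFinset_eq_degree, ← Fintype.card_coe]
    refine Fintype.card_le_of_injective
      (fun h => ⟨if h.1.2 then h.1.1.1.1 else h.1.1.1.2, ?_⟩) ?_
    · obtain ⟨⟨⟨⟨u, w⟩, huw, hlt⟩, b⟩, rfl⟩ := h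
      cases b
      · simpa [s] using huw
      · simpa [s] using huw.symm
    · rintro ⟨⟨⟨⟨u, w⟩, huw, hlt⟩, b⟩, hh⟩ ⟨⟨⟨⟨u', w'⟩, huw', hlt'⟩, b'⟩, hh'⟩ heq
      cases b <;> cases b' <;> simp [s] at hh hh' heq hlt hlt' ⊢ <;> grind
  choose τ hτc hτ using fun v => exists_continuous_vertex (q := q) (hs v)
  refine ⟨fun p => ∑ a : E → Bool → Fin q,
    (∏ v, τ v p.1 fun h => a h.1.1 h.1.2) * ∏ e, p.2 (a e false) (a e true), ?_, fun H _ T => ?_⟩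
  · refine continuous_finsetSum _ fun a _ => Continuous.mul
      (continuous_finsetProd _ fun v _ => (hτc v _).comp continuous_fst)
      (continuous_finsetProd _ fun e _ => continuous_snd.matrix_elem _ _)
  · rw [← sum_prod_adjMatrix]
    simp only [holTransform, hτ]
    rw [sum_contraction]
    have hTT (S : Matrix (Fin q) (Fin q) ℂ) (hS : S * (T : Matrix (Fin q) (Fin q) ℂ) = 1) :
        (T : Matrix (Fin q) (Fin q) ℂ)ᵀ * (Sᵀ * H.adjMatrix ℂ * S) *
          (T : Matrix (Fin q) (Fin q) ℂ) = H.adjMatrix ℂ := by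
      calc _ = (S * (T : Matrix (Fin q) (Fin q) ℂ))ᵀ * H.adjMatrix ℂ *
            (S * (T : Matrix (Fin q) (Fin q) ℂ)) := by
            simp only [Matrix.transpose_mul, Matrix.mul_assoc]
        _ = _ := by rw [hS]; simp
    rw [hTT _ T.inv_mul]
    simp [s, E]

lemma hom_count_eq_of_closure_inter_nonempty {F G : SimpleGraph (Fin q)} [DecidableRel F.Adj]
    [DecidableRel G.Adj]
    (h : (closure {p : ((n : Fin d) → ((Fin (n.1 + 1) → Fin q) → ℂ)) ×
          Matrix (Fin q) (Fin q) ℂ | ∃ T : GL (Fin q) ℂ, p = holTransform T F} ∩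
      closure {p : ((n : Fin d) → ((Fin (n.1 + 1) → Fin q) → ℂ)) ×
          Matrix (Fin q) (Fin q) ℂ | ∃ T : GL (Fin q) ℂ, p = holTransform T G}).Nonempty)
    {m : ℕ} (X : SimpleGraph (Fin m)) [DecidableRel X.Adj] (hX : ∀ v, X.degree v ≤ d) :
    Fintype.card (X →g F) = Fintype.card (X →g G) := by
  obtain ⟨Ψ, hΨ, hcount⟩ := exists_continuous_hom_count (q := q) X hX
  have hconst (H : SimpleGraph (Fin q)) [DecidableRel H.Adj] {p}
      (hp : p ∈ closure {p : ((n : Fin d) → ((Fin (n.1 + 1) → Fin q) → ℂ)) ×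
          Matrix (Fin q) (Fin q) ℂ | ∃ T : GL (Fin q) ℂ, p = holTransform T H}) :
      Ψ p = Fintype.card (X →g H) := by
    refine closure_minimal ?_ (isClosed_eq hΨ continuous_const) hp
    rintro _ ⟨T, rfl⟩
    exact hcount H T
  obtain ⟨p, hpF, hpG⟩ := h
  exact_mod_cast (hconst F hpF).symm.trans (hconst G hpG)

end OrbitInvariants

section OrbitClosures

open Filter Topology

variable {q d : ℕ}

lemma mem_closure_holTransform (H : SimpleGraph (Fin q)) [DecidableRel H.Adj]
    {T S : ℕ → Matrix (Fin q) (Fin q) ℝ} (hTS : ∀ k, T k * S k = 1)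
    {t : (n : Fin d) → (Fin (n.1 + 1) → Fin q) → ℝ} {C : Matrix (Fin q) (Fin q) ℝ}
    (ht : ∀ n a, Tendsto (fun k => ∑ b, ∏ j, T k (a j) b) atTop (𝓝 (t n a)))
    (hC : Tendsto (fun k => (S k)ᵀ * H.adjMatrix ℝ * S k) atTop (𝓝 C)) :
    ((fun n a => (t n a : ℂ)), C.map Complex.ofReal) ∈
      closure {p : ((n : Fin d) → ((Fin (n.1 + 1) → Fin q) → ℂ)) ×
        Matrix (Fin q) (Fin q) ℂ | ∃ T : GL (Fin q) ℂ, p = holTransform T H} := by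
  let φ := Complex.ofRealHom.mapMatrix (m := Fin q)
  let U (k : ℕ) : GL (Fin q) ℂ := ⟨φ (T k), φ (S k), by rw [← map_mul, hTS, map_one],
    by rw [← map_mul, mul_eq_one_comm.1 (hTS k), map_one]⟩
  have hU (k : ℕ) : ((fun n a => ((∑ b, ∏ j, T k (a j) b : ℝ) : ℂ)),
      ((S k)ᵀ * H.adjMatrix ℝ * S k).map Complex.ofReal) = holTransform (d := d) (U k) H := by
    have hadj : H.adjMatrix ℂ = φ (H.adjMatrix ℝ) := by
      ext i j; simp [φ, SimpleGraph.adjMatrix_apply, apply_ite]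
    have hS : (φ (S k))ᵀ = φ (S k)ᵀ := rfl
    have hinv : (((U k)⁻¹ : GL (Fin q) ℂ) : Matrix (Fin q) (Fin q) ℂ) = φ (S k) := rfl
    have hval : ((U k : GL (Fin q) ℂ) : Matrix (Fin q) (Fin q) ℂ) = φ (T k) := rfl
    unfold holTransform
    rw [hinv, hval, hadj, hS, ← map_mul, ← map_mul]
    refine Prod.ext ?_ rfl
    ext n a
    simp [φ]
  refine mem_closure_of_tendsto (b := atTop) (f := fun k => holTransform (U k) H) ?_
    (Eventually.of_forall fun k => ⟨U k, rfl⟩)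
  simp only [← hU]
  refine Tendsto.prodMk_nhds ?_ ?_
  · exact tendsto_pi_nhds.2 fun n => tendsto_pi_nhds.2 fun a =>
      (Complex.continuous_ofReal.tendsto _).comp (ht n a)
  · exact ((continuous_id.matrix_map Complex.continuous_ofReal).tendsto C).comp hC

lemma add_smul_mul_add_smul {P : Matrix (Fin q) (Fin q) ℝ} (hP : P * P = P) {a b : ℝ}
    (hab : a * b = 1) : (P + a • (1 - P)) * (P + b • (1 - P)) = 1 := by
  have h1 : P * (1 - P) = 0 := by rw [Matrix.mul_sub, hP]; simp
  have h2 : (1 - P) * P = 0 := by rw [Matrix.sub_mul, hP]; simp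
  have h3 : (1 - P) * (1 - P) = 1 - P := by rw [Matrix.mul_sub, h2]; simp
  simp [Matrix.add_mul, Matrix.mul_add, h1, h2, h3, hP, smul_smul, mul_comm b a, hab]

lemma tendsto_add_smul (P : Matrix (Fin q) (Fin q) ℝ) :
    Tendsto (fun k : ℕ => P + (1 / ((k : ℝ) + 1)) • (1 - P)) atTop (𝓝 P) := by
  simpa using (tendsto_const_nhds (x := P)).add
    ((tendsto_one_div_add_atTop_nhds_zero_nat (𝕜 := ℝ)).smul_const (1 - P))

/-- If `A` is fixed by the symmetric projection `P` and `O` carries `A` to the adjacency matrix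
of `H`, then `(P, A)` bounds the orbit of `H` rotated by `O`. -/
lemma mem_closure_holTransform_of_projection (H : SimpleGraph (Fin q)) [DecidableRel H.Adj]
    {A P O : Matrix (Fin q) (Fin q) ℝ} (hP : P * P = P) (hPt : Pᵀ = P) (hPA : P * A = A)
    (hAP : A * P = A) (hO : Oᵀ * O = 1) (hH : Oᵀ * H.adjMatrix ℝ * O = A) :
    ((fun _ a => ((∑ b, ∏ j, (O * P) b (a j) : ℝ) : ℂ)), A.map Complex.ofReal) ∈
      closure {p : ((n : Fin d) → ((Fin (n.1 + 1) → Fin q) → ℂ)) ×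
        Matrix (Fin q) (Fin q) ℂ | ∃ T : GL (Fin q) ℂ, p = holTransform T H} := by
  refine mem_closure_holTransform H
    (T := fun k => (P + (1 / ((k : ℝ) + 1)) • (1 - P)) * Oᵀ)
    (S := fun k => O * (P + ((k : ℝ) + 1) • (1 - P))) (fun k => ?_) (fun n a => ?_) ?_
  · calc _ = (P + (1 / ((k : ℝ) + 1)) • (1 - P)) * (Oᵀ * O) * (P + ((k : ℝ) + 1) • (1 - P)) := by
          simp only [Matrix.mul_assoc]
      _ = 1 := by
        rw [hO, Matrix.mul_one]
        exact add_smul_mul_add_smul hP (one_div_mul_cancel (by positivity))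
  · have hlim : Tendsto (fun k : ℕ => (P + (1 / ((k : ℝ) + 1)) • (1 - P)) * Oᵀ) atTop
        (𝓝 (O * P)ᵀ) := by
      rw [Matrix.transpose_mul, hPt]
      exact ((continuous_id.matrix_mul continuous_const).tendsto P).comp (tendsto_add_smul P)
    exact tendsto_finsetSum _ fun b _ => tendsto_finsetProd _ fun j _ =>
      ((continuous_id.matrix_elem (a j) b).tendsto _).comp hlim
  · refine tendsto_const_nhds.congr fun k => ?_
    have h1 : A * (P + ((k : ℝ) + 1) • (1 - P)) = A := by
      simp [Matrix.mul_add, Matrix.mul_sub, hAP]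
    have h2 : (P + ((k : ℝ) + 1) • (1 - P))ᵀ * A = A := by
      simp [Matrix.add_mul, Matrix.sub_mul, hPA, hPt]
    calc A = (P + ((k : ℝ) + 1) • (1 - P))ᵀ * A * (P + ((k : ℝ) + 1) • (1 - P)) := by rw [h2, h1]
      _ = _ := by rw [← hH]; simp only [Matrix.transpose_mul, Matrix.mul_assoc]

lemma closure_inter_nonempty_of_two_le (hd : 2 ≤ d) {F G : SimpleGraph (Fin q)}
    [DecidableRel F.Adj] [DecidableRel G.Adj]
    (hFG : ∀ (n : ℕ) (X : SimpleGraph (Fin n)) [DecidableRel X.Adj],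
      (∀ v : Fin n, X.degree v ≤ d) → Fintype.card (X →g F) = Fintype.card (X →g G)) :
    (closure {p : ((n : Fin d) → ((Fin (n.1 + 1) → Fin q) → ℂ)) ×
          Matrix (Fin q) (Fin q) ℂ | ∃ T : GL (Fin q) ℂ, p = holTransform T F} ∩
      closure {p : ((n : Fin d) → ((Fin (n.1 + 1) → Fin q) → ℂ)) ×
          Matrix (Fin q) (Fin q) ℂ | ∃ T : GL (Fin q) ℂ, p = holTransform T G}).Nonempty := by
  let A := F.adjMatrix ℝ
  let B := G.adjMatrix ℝ
  have hAt : Aᵀ = A := F.transpose_adjMatrix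
  have hBt : Bᵀ = B := G.transpose_adjMatrix
  obtain ⟨P, S, hAS, hPt, hPP, hPA, hAP⟩ := exists_range_projection (A := A) hAt
  obtain ⟨R, hstar, hform⟩ := exists_mul_eq_of_multiHom_eq (A := A) (B := B) hd
    (fun V _ _ L hL => multiHom_eq_of_hom_eq hFG hL) S
  rw [hAS] at hstar hform
  set M := B * R
  clear_value M
  have hM : Mᵀ * M = P := by
    suffices Mᵀ * M = Pᵀ * P by rw [this, hPt, hPP]
    ext i j
    simpa [Matrix.mul_apply, Fin.prod_univ_two] using hstar 2 hd ![i, j]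
  obtain ⟨O, hO, hOP⟩ := exists_orthogonal_mul_eq hM hPP
  have htr (C : Matrix (Fin q) (Fin q) ℝ) :
      multiHom C [(false, true), (true, false)] = (C * C).trace := by
    unfold multiHom
    rw [← (Equiv.boolArrowEquivProd (Fin q)).symm.sum_comp, Fintype.sum_prod_type]
    simp [Matrix.trace, Matrix.mul_apply]
  have hAB : (B * B).trace = (A * A).trace := by
    rw [← htr, ← htr]
    refine (multiHom_eq_of_hom_eq hFG fun v => le_trans (le_of_eq ?_) hd).symm
    cases v <;> simp [multiDegree]
  have hO' : O * Oᵀ = 1 := mul_eq_one_comm.1 hO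
  have hC : Oᵀ * B * O = A := by
    refine eq_of_compression hAt ?_ hPA hAP ?_ ?_
    · simp [Matrix.transpose_mul, hBt, Matrix.mul_assoc]
    · calc P * (Oᵀ * B * O) * P = (O * P)ᵀ * B * (O * P) := by
            simp only [Matrix.transpose_mul, hPt, Matrix.mul_assoc]
        _ = A := by rw [hOP, hform, hPt, hPA, hAP]
    · calc (Oᵀ * B * O * (Oᵀ * B * O)).trace = (Oᵀ * (B * (O * Oᵀ) * B * O)).trace := by
            simp only [Matrix.mul_assoc]
        _ = (B * B * (O * Oᵀ)).trace := by
            rw [Matrix.trace_mul_comm, hO']; simp only [Matrix.mul_assoc, Matrix.mul_one, hO']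
        _ = _ := by rw [hO', Matrix.mul_one, hAB]
  refine ⟨_, mem_closure_holTransform_of_projection F (O := 1) hPP hPt hPA hAP (by simp)
    (by simp [A]), ?_⟩
  convert mem_closure_holTransform_of_projection (d := d) G hPP hPt hPA hAP hO hC using 5 with n a
  rw [Matrix.one_mul, hOP, hstar _ n.2]

lemma closure_inter_nonempty_of_eq_one (hq : 0 < q) {F G : SimpleGraph (Fin q)}
    [DecidableRel F.Adj] [DecidableRel G.Adj]
    (hFG : ∀ (n : ℕ) (X : SimpleGraph (Fin n)) [DecidableRel X.Adj],
      (∀ v : Fin n, X.degree v ≤ 1) → Fintype.card (X →g F) = Fintype.card (X →g G)) :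
    (closure {p : ((n : Fin 1) → ((Fin (n.1 + 1) → Fin q) → ℂ)) ×
          Matrix (Fin q) (Fin q) ℂ | ∃ T : GL (Fin q) ℂ, p = holTransform T F} ∩
      closure {p : ((n : Fin 1) → ((Fin (n.1 + 1) → Fin q) → ℂ)) ×
          Matrix (Fin q) (Fin q) ℂ | ∃ T : GL (Fin q) ℂ, p = holTransform T G}).Nonempty := by
  let R : Matrix (Fin q) (Fin q) ℝ := Matrix.of fun _ _ => (q : ℝ)⁻¹
  have hq' : (q : ℝ) ≠ 0 := by positivity
  have hR : R * R = R := by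
    ext i j; simp [R, Matrix.mul_apply, hq']
  have hform (C : Matrix (Fin q) (Fin q) ℝ) :
      Rᵀ * C * R = (multiHom C [(false, true)]) • Matrix.of fun _ _ => (q : ℝ)⁻¹ * (q : ℝ)⁻¹ := by
    have : multiHom C [(false, true)] = ∑ i, ∑ j, C i j := by
      unfold multiHom
      rw [← (Equiv.boolArrowEquivProd (Fin q)).symm.sum_comp, Fintype.sum_prod_type]
      simp
    rw [this]
    ext i j
    simp only [R, Matrix.mul_apply, Matrix.transpose_apply, Matrix.of_apply, Matrix.smul_apply,
      smul_eq_mul, ← Finset.mul_sum, ← Finset.sum_mul]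
    rw [Finset.sum_comm]
    ring
  have hmem (H : SimpleGraph (Fin q)) [DecidableRel H.Adj] :=
    mem_closure_holTransform H (d := 1) (t := fun _ _ => 1) (C := Rᵀ * H.adjMatrix ℝ * R)
      (T := fun k => R + ((k : ℝ) + 1) • (1 - R))
      (S := fun k => R + (1 / ((k : ℝ) + 1)) • (1 - R))
      (fun k => add_smul_mul_add_smul hR (mul_one_div_cancel (by positivity)))
      (fun n a => by
        refine tendsto_const_nhds.congr fun k => ?_
        obtain rfl := Subsingleton.elim n 0
        simp [R, Finset.sum_add_distrib, ← Finset.mul_sum, Matrix.one_apply, hq'])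
      ((((continuous_id.matrix_transpose.matrix_mul continuous_const).matrix_mul
        continuous_id).tendsto R).comp (tendsto_add_smul R))
  have hcount : multiHom (F.adjMatrix ℝ) [(false, true)] =
      multiHom (G.adjMatrix ℝ) [(false, true)] :=
    multiHom_eq_of_hom_eq hFG fun v => by cases v <;> simp [multiDegree]
  refine ⟨_, hmem F, ?_⟩
  rw [hform, hcount, ← hform]
  exact hmem G

end OrbitClosures

/-- Corollary cor:bounded_orbit_cl: two graphs on `q` vertices are
homomorphism-indistinguishable over graphs of maximum degree at most `d` iff
the closures of the `GL_q`-orbits of their bipartite signature sets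
`(=₁,…,=_d | A)` intersect. -/
theorem stmt8 {q d : ℕ} (hq : 0 < q) (hd : 0 < d)
    (F G : SimpleGraph (Fin q)) [DecidableRel F.Adj] [DecidableRel G.Adj] :
    (∀ (n : ℕ) (X : SimpleGraph (Fin n)) [DecidableRel X.Adj],
        (∀ v : Fin n, X.degree v ≤ d) →
        Fintype.card (X →g F) = Fintype.card (X →g G)) ↔
    (closure {p : ((n : Fin d) → ((Fin (n.1 + 1) → Fin q) → ℂ)) ×
          Matrix (Fin q) (Fin q) ℂ | ∃ T : GL (Fin q) ℂ, p = holTransform T F} ∩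
      closure {p : ((n : Fin d) → ((Fin (n.1 + 1) → Fin q) → ℂ)) ×
          Matrix (Fin q) (Fin q) ℂ | ∃ T : GL (Fin q) ℂ, p = holTransform T G}).Nonempty := by
  refine ⟨fun h => ?_, fun h _ X _ hX => hom_count_eq_of_closure_inter_nonempty h X hX⟩
  obtain rfl | hd' := eq_or_lt_of_le (Nat.succ_le_of_lt hd)
  · exact closure_inter_nonempty_of_eq_one hq h
  · exact closure_inter_nonempty_of_two_le hd' h
end

section
/- Let K be an algebraically closed field of characteristic zero, q a positive natural number, and let F, G : ι → Matrix (Fin q) (Fin q) K be trace-equivalent and both (1,1)-quantum-nonvanishing. Then for every noncommutative polynomial p : FreeAlgebra K ι, ev_F p = 0 if and only if ev_G p = 0. (Matrix-family instance of the paper's Proposition prop:covanishing: indistinguishable quantum-nonvanishing families are covanishing.) -/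
/-- Trace-equivalent families have equal traces on every noncommutative polynomial. -/
theorem FreeAlgebra.trace_lift_eq_of_trace_prod_eq {K ι n : Type*} [CommRing K] [Fintype n]
    [DecidableEq n] {F G : ι → Matrix n n K}
    (htr : ∀ w : List ι, Matrix.trace ((w.map F).prod) = Matrix.trace ((w.map G).prod))
    (p : FreeAlgebra K ι) :
    Matrix.trace (FreeAlgebra.lift K F p) = Matrix.trace (FreeAlgebra.lift K G p) := by
  obtain ⟨a, rfl⟩ := (FreeAlgebra.equivMonoidAlgebraFreeMonoid (R := K) (X := ι)).symm.surjective p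
  induction a using MonoidAlgebra.induction_linear with
  | zero => simp
  | add a b ha hb => simp only [map_add, Matrix.trace_add, ha, hb]
  | single w c =>
    have key (H : ι → Matrix n n K) :
        FreeAlgebra.lift K H (FreeAlgebra.equivMonoidAlgebraFreeMonoid.symm
          (MonoidAlgebra.single w c)) = c • (w.toList.map H).prod := by
      simp [FreeAlgebra.equivMonoidAlgebraFreeMonoid, MonoidAlgebra.lift_single,
        FreeMonoid.lift_apply, map_list_prod, Function.comp_def]
    rw [key, key, Matrix.trace_smul, Matrix.trace_smul, htr]

/-- If the trace form is nondegenerate on the algebra generated by `G`, then every polynomial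
vanishing on a trace-equivalent family `F` vanishes on `G`. -/
theorem FreeAlgebra.lift_eq_zero_of_trace_prod_eq {K ι n : Type*} [CommRing K] [Fintype n]
    [DecidableEq n] {F G : ι → Matrix n n K}
    (htr : ∀ w : List ι, Matrix.trace ((w.map F).prod) = Matrix.trace ((w.map G).prod))
    (hG : ∀ M ∈ Algebra.adjoin K (Set.range G), M ≠ 0 →
      ∃ N ∈ Algebra.adjoin K (Set.range G), Matrix.trace (M * N) ≠ 0)
    {p : FreeAlgebra K ι} (hp : FreeAlgebra.lift K F p = 0) : FreeAlgebra.lift K G p = 0 := by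
  by_contra h
  rw [Algebra.adjoin_range_eq_range_freeAlgebra_lift] at hG
  obtain ⟨_, ⟨r, rfl⟩, hr⟩ := hG _ ⟨p, rfl⟩ h
  apply hr
  change Matrix.trace (FreeAlgebra.lift K G p * FreeAlgebra.lift K G r) = 0
  rw [← map_mul, ← trace_lift_eq_of_trace_prod_eq htr, map_mul, hp, zero_mul, Matrix.trace_zero]


/-- Matrix-family instance of Proposition prop:covanishing: trace-equivalent,
(1,1)-quantum-nonvanishing families are covanishing. -/
theorem stmt9 {K : Type*} [Field K] [IsAlgClosed K] [CharZero K]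
    {q : ℕ} (hq : 0 < q) {ι : Type*}
    (F G : ι → Matrix (Fin q) (Fin q) K)
    (htr : ∀ w : List ι, Matrix.trace ((w.map F).prod) = Matrix.trace ((w.map G).prod))
    (hF : ∀ M ∈ Algebra.adjoin K (Set.range F), M ≠ 0 →
      ∃ N ∈ Algebra.adjoin K (Set.range F), Matrix.trace (M * N) ≠ 0)
    (hG : ∀ M ∈ Algebra.adjoin K (Set.range G), M ≠ 0 →
      ∃ N ∈ Algebra.adjoin K (Set.range G), Matrix.trace (M * N) ≠ 0) :
    ∀ p : FreeAlgebra K ι, FreeAlgebra.lift K F p = 0 ↔ FreeAlgebra.lift K G p = 0 := by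
  exact fun p => ⟨FreeAlgebra.lift_eq_zero_of_trace_prod_eq htr hG,
    FreeAlgebra.lift_eq_zero_of_trace_prod_eq (fun w => (htr w).symm) hF⟩
end

section
/- Let K be an algebraically closed field of characteristic zero, q a positive natural number, and F : Matrix (Fin q) (Fin q) K. If the trace bilinear form is nondegenerate on the unital subalgebra K[F] := Algebra.adjoin K {F} (i.e., for every M ∈ K[F] with M ≠ 0 there exists N ∈ K[F] with Matrix.trace (M * N) ≠ 0), then F is diagonalizable: there exist an invertible matrix T and a function d : Fin q → K with F = T * Matrix.diagonal d * T⁻¹. (Claim established in Section 5.1 of the paper: any (1,1)-quantum-nonvanishing single matrix is diagonalizable.) -/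
open Module in
/-- A diagonalizable endomorphism has a basis of eigenvectors with the same index type as any given basis. -/
theorem Module.End.exists_basis_eigenvectors {K V ι : Type*} [Field K] [AddCommGroup V]
    [Module K V] (b : Basis ι K V) {f : End K V} (hf : ⨆ μ : K, f.eigenspace μ = ⊤) :
    ∃ (v : Basis ι K V) (d : ι → K), ∀ i, f (v i) = d i • v i := by
  classical
  have hint := DirectSum.isInternal_submodule_of_iSupIndep_of_iSup_eq_top
    f.eigenspaces_iSupIndep hf
  let c := hint.collectedBasis fun μ => Basis.ofVectorSpace K (f.eigenspace μ)
  let e := c.indexEquiv b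
  refine ⟨c.reindex e, fun i => (e.symm i).1, fun i => ?_⟩
  rw [Basis.reindex_apply]
  exact Module.End.mem_eigenspace_iff.mp (hint.collectedBasis_mem _ _)

/-- A matrix with a basis of eigenvectors is conjugate to a diagonal matrix. -/
theorem Matrix.exists_eq_conj_diagonal_of_basis {K n : Type*} [Field K] [Fintype n]
    [DecidableEq n] (F : Matrix n n K) (v : Module.Basis n K (n → K)) (d : n → K)
    (hv : ∀ i, F.mulVec (v i) = d i • v i) :
    ∃ T : GL n K, F = (T : Matrix n n K) * Matrix.diagonal d * ((T⁻¹ : GL n K) : Matrix n n K) := by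
  let e := Pi.basisFun K n
  let T : GL n K := ⟨e.toMatrix v, v.toMatrix e, e.toMatrix_mul_toMatrix_flip v,
    v.toMatrix_mul_toMatrix_flip e⟩
  refine ⟨T, ?_⟩
  rw [Units.eq_mul_inv_iff_mul_eq]
  ext i j
  rw [Matrix.mul_diagonal, Matrix.mul_apply]
  simpa [T, e, Module.Basis.toMatrix_apply, Matrix.mulVec, dotProduct, mul_comm (d j)] using congrFun (hv j) i

/-- If the trace form is nondegenerate on `K[F]`, then `K[F]` is reduced. -/
theorem Matrix.eq_zero_of_isNilpotent_of_mem_adjoin {K n : Type*} [Field K] [Fintype n]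
    [DecidableEq n] {F : Matrix n n K}
    (hnd : ∀ M ∈ Algebra.adjoin K ({F} : Set (Matrix n n K)), M ≠ 0 →
      ∃ N ∈ Algebra.adjoin K ({F} : Set (Matrix n n K)), Matrix.trace (M * N) ≠ 0)
    {M : Matrix n n K} (hM : M ∈ Algebra.adjoin K ({F} : Set (Matrix n n K)))
    (hnil : IsNilpotent M) : M = 0 := by
  by_contra hne
  obtain ⟨N, hN, htr⟩ := hnd M hM hne
  rw [Algebra.adjoin_singleton_eq_range_aeval] at hM hN
  obtain ⟨p, rfl⟩ := hM
  obtain ⟨r, rfl⟩ := hN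
  have hcomm : Commute (Polynomial.aeval F p) (Polynomial.aeval F r) :=
    (Commute.all p r).map (Polynomial.aeval F)
  exact htr (Matrix.isNilpotent_trace_of_isNilpotent (hcomm.isNilpotent_mul_right hnil)).eq_zero

/-- Over a perfect field, if `K[F]` is reduced then `F` is a semisimple endomorphism. -/
theorem Matrix.isSemisimple_toLin'_of_adjoin_reduced {K n : Type*} [Field K] [PerfectField K]
    [Fintype n] [DecidableEq n] {F : Matrix n n K}
    (hred : ∀ M ∈ Algebra.adjoin K ({F} : Set (Matrix n n K)), IsNilpotent M → M = 0) :
    Module.End.IsSemisimple (Matrix.toLin' F) := by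
  obtain ⟨m, hm, s, -, hnil, hs, hF⟩ :=
    Module.End.exists_isNilpotent_isSemisimple (f := Matrix.toLin' F)
  rw [Algebra.adjoin_singleton_eq_range_aeval] at hm
  obtain ⟨p, rfl⟩ := hm
  have hp : Polynomial.aeval (Matrix.toLin' F) p =
      Matrix.toLinAlgEquiv' (Polynomial.aeval F p) :=
    Polynomial.aeval_algHom_apply (Matrix.toLinAlgEquiv' (R := K) (n := n)) F p
  have hzero : Polynomial.aeval F p = 0 := by
    refine hred _ (Polynomial.aeval_mem_adjoin_singleton K F) ?_
    rw [← IsNilpotent.map_iff (f := Matrix.toLinAlgEquiv' (R := K) (n := n))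
      (AlgEquiv.injective _), ← hp]
    exact hnil
  have hFs : Matrix.toLin' F = s := by
    rw [hF]
    simp [hp, hzero]
  rwa [hFs]

/-- Section 5.1 claim: a single (1,1)-quantum-nonvanishing matrix is
diagonalizable. -/
theorem stmt10 {K : Type*} [Field K] [IsAlgClosed K] [CharZero K]
    {q : ℕ} (hq : 0 < q) (F : Matrix (Fin q) (Fin q) K)
    (hnd : ∀ M ∈ Algebra.adjoin K ({F} : Set (Matrix (Fin q) (Fin q) K)), M ≠ 0 →
      ∃ N ∈ Algebra.adjoin K ({F} : Set (Matrix (Fin q) (Fin q) K)),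
        Matrix.trace (M * N) ≠ 0) :
    ∃ (T : GL (Fin q) K) (d : Fin q → K),
      F = (T : Matrix (Fin q) (Fin q) K) * Matrix.diagonal d *
        ((T⁻¹ : GL (Fin q) K) : Matrix (Fin q) (Fin q) K) := by
  obtain ⟨v, d, hv⟩ := Module.End.exists_basis_eigenvectors (f := Matrix.toLin' F)
    (Pi.basisFun K (Fin q))
    (Matrix.isSemisimple_toLin'_of_adjoin_reduced fun _ hM =>
      Matrix.eq_zero_of_isNilpotent_of_mem_adjoin hnd hM).iSup_eigenspace_eq_top
  obtain ⟨T, hT⟩ := Matrix.exists_eq_conj_diagonal_of_basis F v d fun i => by simpa using hv i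
  exact ⟨T, d, hT⟩
end

section
/- Let K be an algebraically closed field of characteristic zero, q a positive natural number, and A a unital subalgebra of Matrix (Fin q) (Fin q) K on which the trace bilinear form is nondegenerate. Let X : Fin m → Finset (Fin q) be a partition of Fin q (the X i are pairwise disjoint, nonempty, and their union is Fin q), write P i := I_{X i}, and suppose P i ∈ A for every i and that each corner is trivial: for every i and every M ∈ A there exists c : K with P i * M * P i = c • P i. Then for all i ≠ j and every M ∈ A with P i * M * P j ≠ 0: the blocks are square, i.e., (X i).card = (X j).card, and there exist N ∈ A and c : K with c ≠ 0 such that (P i * M * P j) * (P j * N * P i) = c • P i and (P j * N * P i) * (P i * M * P j) = c • P j. (Key step, equations (eq:block_i)–(eq:fij), in the proof of the paper's Theorem thm:binary.) -/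
/-- The trace of a diagonal indicator matrix is the cardinality of the indexing set. -/
theorem trace_diagonal_indicator {K n : Type*} [Semiring K] [Fintype n] [DecidableEq n]
    (s : Finset n) :
    Matrix.trace (Matrix.diagonal fun a => if a ∈ s then (1 : K) else 0) = s.card := by
  simp [Matrix.trace_diagonal]

/-- If `p * x * r` is a nonzero block between idempotents with trivial corners, then the two
scalars obtained by multiplying it on either side with a block `r * y * p` agree. -/
theorem eq_of_block_mul_block {K R : Type*} [Field K] [Ring R] [Algebra K R] {p r x y : R}
    {c d : K} (hp : p * p = p) (hr : r * r = r) (hx : p * x * r ≠ 0)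
    (hc : (p * x * r) * (r * y * p) = c • p) (hd : (r * y * p) * (p * x * r) = d • r) :
    c = d := by
  apply smul_left_injective K hx
  calc c • (p * x * r) = (c • p) * (p * x * r) := by
        rw [smul_mul_assoc, ← mul_assoc, ← mul_assoc, hp]
    _ = (p * x * r) * (d • r) := by rw [← hc, mul_assoc, hd]
    _ = d • (p * x * r) := by rw [mul_smul_comm, mul_assoc, hr]


/-- Key step (eq:block_i)–(eq:fij) in the proof of Theorem thm:binary: under a
partition into trivial corners, every nonzero off-diagonal block of an element
of the algebra is invertible between blocks of equal size. -/
theorem stmt12 {K : Type*} [Field K] [IsAlgClosed K] [CharZero K]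
    {q m : ℕ} (hq : 0 < q)
    (A : Subalgebra K (Matrix (Fin q) (Fin q) K))
    (hnd : ∀ M ∈ A, M ≠ 0 → ∃ N ∈ A, Matrix.trace (M * N) ≠ 0)
    (X : Fin m → Finset (Fin q))
    (hdisj : ∀ i j : Fin m, i ≠ j → Disjoint (X i) (X j))
    (hne : ∀ i : Fin m, (X i).Nonempty)
    (hcover : Finset.univ.biUnion X = (Finset.univ : Finset (Fin q)))
    (P : Fin m → Matrix (Fin q) (Fin q) K)
    (hP : ∀ i : Fin m, P i = Matrix.diagonal (fun a => if a ∈ X i then (1 : K) else 0))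
    (hPA : ∀ i : Fin m, P i ∈ A)
    (htriv : ∀ i : Fin m, ∀ M ∈ A, ∃ c : K, P i * M * P i = c • P i) :
    ∀ i j : Fin m, i ≠ j → ∀ M ∈ A, P i * M * P j ≠ 0 →
      (X i).card = (X j).card ∧
      ∃ N ∈ A, ∃ c : K, c ≠ 0 ∧
        (P i * M * P j) * (P j * N * P i) = c • P i ∧
        (P j * N * P i) * (P i * M * P j) = c • P j := by
  intro i j _ M hM hB
  have idem (k : Fin m) : P k * P k = P k := by
    rw [hP k, Matrix.diagonal_mul_diagonal]
    congr 1
    ext a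
    split_ifs <;> simp
  have htr (k : Fin m) : Matrix.trace (P k) = (X k).card := by
    rw [hP k, trace_diagonal_indicator]
  obtain ⟨N, hN, hMN⟩ := hnd _ (A.mul_mem (A.mul_mem (hPA i) hM) (hPA j)) hB
  obtain ⟨c, hc⟩ := htriv i _ (A.mul_mem (A.mul_mem hM (hPA j)) hN)
  obtain ⟨d, hd⟩ := htriv j _ (A.mul_mem (A.mul_mem hN (hPA i)) hM)
  have block (k l : Fin m) (S T : Matrix (Fin q) (Fin q) K) :
      (P k * S * P l) * (P l * T * P k) = P k * (S * P l * T) * P k := by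
    rw [show (P k * S * P l) * (P l * T * P k) = P k * S * (P l * P l) * T * P k by
      simp only [mul_assoc], idem]
    simp only [mul_assoc]
  rw [← block] at hc hd
  obtain rfl : c = d := eq_of_block_mul_block (idem i) (idem j) hB hc hd
  have hci : Matrix.trace (P i * M * P j * N) = c * (X i).card := by
    rw [← htr i, ← smul_eq_mul c, ← Matrix.trace_smul, ← hc, block, Matrix.trace_mul_comm (P i * _),
      ← mul_assoc, idem]
    simp only [mul_assoc]
  have hc0 : c ≠ 0 := by
    rintro rfl
    exact hMN (by rw [hci, zero_mul])
  refine ⟨?_, N, hN, c, hc0, hc, hd⟩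
  have h := Matrix.trace_mul_comm (P i * M * P j) (P j * N * P i)
  rw [hc, hd, Matrix.trace_smul, Matrix.trace_smul, htr, htr] at h
  exact_mod_cast mul_left_cancel₀ hc0 h
end

section
/- Let K be an algebraically closed field of characteristic zero, q a positive natural number, and let F, G : ι → Matrix (Fin q) (Fin q) K be trace-equivalent. Define the direct-sum family D : ι → Matrix (Fin q ⊕ Fin q) (Fin q ⊕ Fin q) K by D i := Matrix.fromBlocks (F i) 0 0 (G i). Then D is (1,1)-quantum-nonvanishing if and only if both F and G are (1,1)-quantum-nonvanishing. (Matrix-family instance of the paper's Lemma lem:oplus.) -/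
/-- A linear map on a free algebra which vanishes on all words is zero. -/
theorem FreeAlgebra.linearMap_eq_zero_of_words {K ι V : Type*} [CommSemiring K]
    [AddCommMonoid V] [Module K V] (τ : FreeAlgebra K ι →ₗ[K] V)
    (hτ : ∀ w : List ι, τ ((w.map (FreeAlgebra.ι K)).prod) = 0) (p : FreeAlgebra K ι) :
    τ p = 0 := by
  have key : ∀ b : FreeAlgebra K ι, (∀ w : List ι, τ (b * (w.map (FreeAlgebra.ι K)).prod) = 0) →
      ∀ w : List ι, τ (b * p * (w.map (FreeAlgebra.ι K)).prod) = 0 := by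
    induction p using FreeAlgebra.induction with
    | grade0 r =>
      intro b hb w
      rw [← Algebra.commutes, mul_assoc, ← Algebra.smul_def, map_smul, hb, smul_zero]
    | grade1 i =>
      intro b hb w
      simpa [mul_assoc] using hb (i :: w)
    | mul x y hx hy =>
      intro b hb w
      simpa [mul_assoc] using hy (b * x) (hx b hb) w
    | add x y hx hy =>
      intro b hb w
      rw [mul_add, add_mul, map_add, hx b hb, hy b hb, add_zero]
  simpa using key 1 (by simpa using hτ) []

/-- Trace-equivalent families have equal traces on every noncommutative polynomial. -/
theorem FreeAlgebra.trace_lift_eq_of_words {K ι m n : Type*} [CommRing K] [Fintype m]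
    [DecidableEq m] [Fintype n] [DecidableEq n] (F : ι → Matrix m m K) (G : ι → Matrix n n K)
    (h : ∀ w : List ι, Matrix.trace ((w.map F).prod) = Matrix.trace ((w.map G).prod))
    (p : FreeAlgebra K ι) :
    Matrix.trace (FreeAlgebra.lift K F p) = Matrix.trace (FreeAlgebra.lift K G p) := by
  have := FreeAlgebra.linearMap_eq_zero_of_words
    (Matrix.traceLinearMap m K K ∘ₗ (FreeAlgebra.lift K F).toLinearMap -
      Matrix.traceLinearMap n K K ∘ₗ (FreeAlgebra.lift K G).toLinearMap)
    (fun w => by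
      simpa [map_list_prod, List.map_map, Function.comp_def, sub_eq_zero] using h w) p
  simpa [sub_eq_zero] using this

/-- Evaluation of a noncommutative polynomial at a direct sum of matrix families. -/
theorem FreeAlgebra.lift_fromBlocks {K ι m n : Type*} [CommRing K] [Fintype m]
    [DecidableEq m] [Fintype n] [DecidableEq n] (F : ι → Matrix m m K) (G : ι → Matrix n n K)
    (p : FreeAlgebra K ι) :
    FreeAlgebra.lift K (fun i => Matrix.fromBlocks (F i) 0 0 (G i)) p =
      Matrix.fromBlocks (FreeAlgebra.lift K F p) 0 0 (FreeAlgebra.lift K G p) := by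
  induction p using FreeAlgebra.induction with
  | grade0 r =>
    simp [Algebra.algebraMap_eq_smul_one, ← Matrix.fromBlocks_one, Matrix.fromBlocks_smul]
  | grade1 i => simp
  | mul x y hx hy => simp [hx, hy, Matrix.fromBlocks_multiply]
  | add x y hx hy => simp [hx, hy, Matrix.fromBlocks_add]

/-- Nondegeneracy of the trace form in terms of noncommutative polynomials. -/
theorem FreeAlgebra.trace_nondegenerate_adjoin_iff {K ι n : Type*} [CommRing K] [Fintype n]
    [DecidableEq n] (F : ι → Matrix n n K) :
    (∀ M ∈ Algebra.adjoin K (Set.range F), M ≠ 0 →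
      ∃ N ∈ Algebra.adjoin K (Set.range F), Matrix.trace (M * N) ≠ 0) ↔
    ∀ p : FreeAlgebra K ι, FreeAlgebra.lift K F p ≠ 0 →
      ∃ r, Matrix.trace (FreeAlgebra.lift K F (p * r)) ≠ 0 := by
  simp [Algebra.adjoin_range_eq_range_freeAlgebra_lift]


/-- Matrix-family instance of Lemma lem:oplus: for trace-equivalent families,
the direct-sum family is (1,1)-quantum-nonvanishing iff both summand families
are. -/
theorem stmt13 {K : Type*} [Field K] [IsAlgClosed K] [CharZero K]
    {q : ℕ} (hq : 0 < q) {ι : Type*}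
    (F G : ι → Matrix (Fin q) (Fin q) K)
    (htr : ∀ w : List ι, Matrix.trace ((w.map F).prod) = Matrix.trace ((w.map G).prod)) :
    (∀ M ∈ Algebra.adjoin K (Set.range
        (fun i => Matrix.fromBlocks (F i) 0 0 (G i))), M ≠ 0 →
      ∃ N ∈ Algebra.adjoin K (Set.range
        (fun i => Matrix.fromBlocks (F i) 0 0 (G i))), Matrix.trace (M * N) ≠ 0) ↔
    ((∀ M ∈ Algebra.adjoin K (Set.range F), M ≠ 0 →
        ∃ N ∈ Algebra.adjoin K (Set.range F), Matrix.trace (M * N) ≠ 0) ∧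
     (∀ M ∈ Algebra.adjoin K (Set.range G), M ≠ 0 →
        ∃ N ∈ Algebra.adjoin K (Set.range G), Matrix.trace (M * N) ≠ 0)) := by
  have tr := FreeAlgebra.trace_lift_eq_of_words F G htr
  have trD (p : FreeAlgebra K ι) :
      Matrix.trace (FreeAlgebra.lift K (fun i => Matrix.fromBlocks (F i) 0 0 (G i)) p) =
        2 * Matrix.trace (FreeAlgebra.lift K F p) := by
    simpa [FreeAlgebra.lift_fromBlocks, Matrix.trace, two_mul] using (tr p).symm
  have neD (p : FreeAlgebra K ι) :
      FreeAlgebra.lift K (fun i => Matrix.fromBlocks (F i) 0 0 (G i)) p ≠ 0 ↔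
        FreeAlgebra.lift K F p ≠ 0 ∨ FreeAlgebra.lift K G p ≠ 0 := by
    rw [FreeAlgebra.lift_fromBlocks, ← Matrix.fromBlocks_zero, Ne, Matrix.fromBlocks_inj]
    tauto
  simp only [FreeAlgebra.trace_nondegenerate_adjoin_iff, trD, neD, ← tr, or_imp, forall_and,
    mul_ne_zero_iff, ne_eq, OfNat.ofNat_ne_zero, not_false_eq_true, true_and]
end

section
/- For every q a positive natural number and every F : Matrix (Fin q) (Fin q) ℂ, there exists d : Fin q → ℂ such that Matrix.diagonal d has the same characteristic polynomial as F and Matrix.diagonal d lies in the topological closure of the similarity orbit { ↑T * F * ↑(T⁻¹) | T : GL (Fin q) ℂ } of F. (Claim established in Section 5.1 of the paper: the diagonal part of the Jordan form of F lies in the closure of the GL-orbit of F, witnessed by conjugation by diag(ε^q, …, ε, 1) as ε → 0.) -/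
open Module in
/-- Every endomorphism of a finite-dimensional space over an algebraically closed field is
represented by a lower triangular matrix in some basis. -/
theorem exists_basis_repr_apply_eq_zero_of_lt {K : Type*} [Field K] [IsAlgClosed K] (n : ℕ) :
    ∀ {V : Type*} [AddCommGroup V] [Module K V] [FiniteDimensional K V],
      finrank K V = n → ∀ f : End K V,
        ∃ b : Basis (Fin n) K V, ∀ i j, i < j → b.repr (f (b j)) i = 0 := by
  induction n with
  | zero =>
    intro V _ _ _ hV f
    exact ⟨finBasisOfFinrankEq K V hV, fun i => i.elim0⟩
  | succ n ih =>
    intro V _ _ _ hV f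
    have : Nontrivial V := nontrivial_of_finrank_pos (R := K) (by omega)
    obtain ⟨μ, hμ⟩ := End.exists_eigenvalue f
    have hrange : LinearMap.range (f - algebraMap K (End K V) μ) < ⊤ := by
      rw [lt_top_iff_ne_top, Ne, ← LinearMap.ker_eq_bot_iff_range_eq_top,
        Algebra.algebraMap_eq_smul_one, ← End.eigenspace_def]
      exact hμ
    obtain ⟨φ, hφ, hle⟩ := Submodule.exists_le_ker_of_lt_top _ hrange
    set W := LinearMap.ker φ with hW
    have hdim : finrank K W = n := by
      have := Module.Dual.finrank_ker_add_one_of_ne_zero hφ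
      rw [← hW, hV] at this
      omega
    have hinv : ∀ w ∈ W, f w ∈ W := by
      intro w hw
      have h := hle (LinearMap.mem_range_self (f - algebraMap K (End K V) μ) w)
      have h2 := W.add_mem h (W.smul_mem μ hw)
      simpa using h2
    obtain ⟨b, hb⟩ := ih hdim (f.restrict hinv)
    obtain ⟨y, hy⟩ : ∃ y, φ y ≠ 0 := by
      by_contra! h
      exact hφ (LinearMap.ext h)
    let B : Basis (Fin (n + 1)) K V := Basis.mkFinCons y b
      (fun c x hx h => by
        have h3 := congrArg φ h
        have h4 : φ x = 0 := hx
        simpa [h4, hy] using h3)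
      (fun z => ⟨-(φ z / φ y), by simp [hW, hy]⟩)
    have hBsucc (i : Fin n) : B i.succ = b i := by simp [B]
    have hrepr (w : W) : B.repr w = (b.repr w).mapDomain Fin.succ := by
      have : B.repr.toLinearMap ∘ₗ W.subtype =
          Finsupp.lmapDomain K K Fin.succ ∘ₗ b.repr.toLinearMap :=
        b.ext fun i => by simp [← hBsucc, Finsupp.mapDomain_single]
      exact LinearMap.congr_fun this w
    refine ⟨B, fun i j hij => ?_⟩
    cases j using Fin.cases with
    | zero => exact absurd hij (Fin.not_lt_zero i)
    | succ j =>
      have hf : f (B j.succ) = (f.restrict hinv (b j) : W) := by simp [hBsucc]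
      rw [hf, hrepr]
      cases i using Fin.cases with
      | zero => exact Finsupp.mapDomain_of_notMem_range _ _ (by simp)
      | succ i =>
        rw [Finsupp.mapDomain_apply (Fin.succ_injective n)]
        exact hb i j (Fin.succ_lt_succ_iff.mp hij)

/-- Every square matrix over an algebraically closed field is similar to a lower triangular
matrix. -/
theorem Matrix.exists_conj_apply_eq_zero_of_lt {K : Type*} [Field K] [IsAlgClosed K] {n : ℕ}
    (F : Matrix (Fin n) (Fin n) K) :
    ∃ P : GL (Fin n) K, ∀ i j, i < j → (P.val * F * P⁻¹.val) i j = 0 := by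
  obtain ⟨b, hb⟩ := exists_basis_repr_apply_eq_zero_of_lt n (K := K) (V := Fin n → K) (by simp)
    (Matrix.toLin' F)
  let c := Pi.basisFun K (Fin n)
  refine ⟨⟨b.toMatrix c, c.toMatrix b, b.toMatrix_mul_toMatrix_flip c,
    c.toMatrix_mul_toMatrix_flip b⟩, fun i j hij => ?_⟩
  have h := basis_toMatrix_mul_linearMap_toMatrix_mul_basis_toMatrix b c b c (Matrix.toLin' F)
  have hF : LinearMap.toMatrix c c (Matrix.toLin' F) = F := LinearMap.toMatrix'_toLin' F
  rw [hF] at h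
  change (b.toMatrix c * F * c.toMatrix b) i j = 0
  rw [h, LinearMap.toMatrix_apply]
  exact hb i j hij

/-- A lower triangular matrix has the same characteristic polynomial as its diagonal part. -/
theorem Matrix.charpoly_diagonal_diag_of_apply_eq_zero_of_lt {R : Type*} [CommRing R] {n : ℕ}
    {A : Matrix (Fin n) (Fin n) R} (hA : ∀ i j, i < j → A i j = 0) :
    (Matrix.diagonal A.diag).charpoly = A.charpoly := by
  rw [← Matrix.charpoly_transpose A, Matrix.charpoly_of_isUpperTriangular A.transpose
    (fun i j hij => hA j i hij), Matrix.charpoly_diagonal]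
  rfl

open Filter Topology in
/-- The diagonal part of a lower triangular matrix is a limit of its conjugates by invertible
diagonal matrices. -/
theorem Matrix.diagonal_diag_mem_closure_of_apply_eq_zero_of_lt {n : ℕ}
    {A : Matrix (Fin n) (Fin n) ℂ} (hA : ∀ i j, i < j → A i j = 0) :
    Matrix.diagonal A.diag ∈
      closure {M | ∃ T : GL (Fin n) ℂ, M = T.val * A * T⁻¹.val} := by
  let g : ℂ → Matrix (Fin n) (Fin n) ℂ := fun ε => Matrix.of fun i j => ε ^ (i.val - j.val) * A i j
  have hg : Continuous g := continuous_matrix fun i j => by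
    simp only [g, Matrix.of_apply]
    fun_prop
  have hg0 : g 0 = Matrix.diagonal A.diag := by
    ext i j
    rcases lt_trichotomy i j with h | rfl | h
    · simp [g, hA i j h, Matrix.diagonal_apply_ne _ h.ne]
    · simp [g]
    · have : i.val - j.val ≠ 0 := by have := Fin.lt_def.mp h; omega
      simp [g, this, Matrix.diagonal_apply_ne _ h.ne']
  have hlim : Tendsto g (𝓝[≠] 0) (𝓝 (Matrix.diagonal A.diag)) :=
    hg0 ▸ (hg.tendsto 0).mono_left nhdsWithin_le_nhds
  refine mem_closure_of_tendsto hlim ?_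
  filter_upwards [self_mem_nhdsWithin] with ε hε
  have hε : ε ≠ 0 := hε
  refine ⟨⟨Matrix.diagonal fun i => ε ^ i.val, Matrix.diagonal fun i => (ε ^ i.val)⁻¹,
    by simp [hε], by simp [hε]⟩, ?_⟩
  change g ε = (Matrix.diagonal fun i => ε ^ i.val) * A * Matrix.diagonal fun i => (ε ^ i.val)⁻¹
  ext i j
  rw [Matrix.mul_diagonal, Matrix.diagonal_mul]
  rcases lt_or_ge i j with h | h
  · simp [g, hA i j h]
  · simp only [g, Matrix.of_apply, pow_sub₀ ε hε (Fin.le_def.mp h)]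
    ring

/-- Section 5.1 claim: the diagonal part of the Jordan form of a complex matrix
lies in the closure of its similarity orbit and has the same characteristic
polynomial. -/
theorem stmt15 {q : ℕ} (hq : 0 < q) (F : Matrix (Fin q) (Fin q) ℂ) :
    ∃ d : Fin q → ℂ,
      (Matrix.diagonal d).charpoly = F.charpoly ∧
      Matrix.diagonal d ∈ closure {M : Matrix (Fin q) (Fin q) ℂ | ∃ T : GL (Fin q) ℂ,
        M = (T : Matrix (Fin q) (Fin q) ℂ) * F *
          ((T⁻¹ : GL (Fin q) ℂ) : Matrix (Fin q) (Fin q) ℂ)} := by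
  obtain ⟨P, hP⟩ := Matrix.exists_conj_apply_eq_zero_of_lt F
  refine ⟨(P.val * F * P⁻¹.val).diag, ?_, ?_⟩
  · rw [Matrix.charpoly_diagonal_diag_of_apply_eq_zero_of_lt hP, Matrix.coe_units_inv, Matrix.charpoly_units_conj]
  · refine closure_mono ?_ (Matrix.diagonal_diag_mem_closure_of_apply_eq_zero_of_lt hP)
    rintro M ⟨T, rfl⟩
    exact ⟨T * P, by simp only [mul_inv_rev, Units.val_mul, mul_assoc]⟩
end

section
/- Let q be a positive natural number, ι a type, and let F, G : ι → Matrix (Fin q) (Fin q) ℂ be conjugate-closed families, meaning there is a map c : ι → ι with c ∘ c = id such that F (c i) is the entrywise complex conjugate of F i and G (c i) is the entrywise complex conjugate of G i, for every i. For a transpose-decorated word w : List (ι × Bool), let F^w denote the product over the letters (i, b) of w of F i if b = false and of (F i)ᵀ if b = true, and similarly G^w. Then Matrix.trace (F^w) = Matrix.trace (G^w) for every w : List (ι × Bool) if and only if there exists a complex orthogonal matrix T (T * Tᵀ = 1) with T * F i * Tᵀ = G i for every i : ι. (Instance, for families of binary signatures viewed as matrices, of the paper's Corollary cor:complex, confirming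 Young's conjecture: for conjugate-closed complex signature sets, Holant-indistinguishability is equivalent to a complex orthogonal holographic transformation.) -/
open Matrix

/-- The product of a transpose-decorated word `w` in the family `F`:
letters `(i, false)` contribute `F i` and letters `(i, true)` contribute
`(F i)ᵀ`. -/
noncomputable def decoratedWordProd {q : ℕ} {ι : Type*} (F : ι → Matrix (Fin q) (Fin q) ℂ)
    (w : List (ι × Bool)) : Matrix (Fin q) (Fin q) ℂ :=
  (w.map (fun p => if p.2 then (F p.1)ᵀ else F p.1)).prod

section TraceForm

variable {n : Type*} [Fintype n]

theorem exists_frame_of_posDef {V : Type*} [AddCommGroup V] [Module ℝ V] [FiniteDimensional ℝ V]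
    (B : V →ₗ[ℝ] V →ₗ[ℝ] ℝ) (hsymm : ∀ x y, B x y = B y x) (hnonneg : ∀ x, 0 ≤ B x x)
    (hdef : ∀ x, B x x = 0 → x = 0) :
    ∃ (d : ℕ) (e : Fin d → V), ∀ v, v = ∑ k, B (e k) v • e k := by
  let core : InnerProductSpace.Core ℝ V :=
    { inner := fun x y => B x y
      conj_inner_symm := fun x y => by simp [hsymm y x]
      re_inner_nonneg := fun x => by simpa using hnonneg x
      add_left := fun x y z => by simp
      smul_left := fun x y r => by simp
      definite := hdef }
  let _ : NormedAddCommGroup V := core.toNormedAddCommGroup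
  let _ : InnerProductSpace ℝ V := InnerProductSpace.ofCore core.toCore
  exact ⟨_, stdOrthonormalBasis ℝ V, fun v => ((stdOrthonormalBasis ℝ V).sum_repr' v).symm⟩

theorem trace_transpose_mul_self_nonneg (A : Matrix n n ℝ) : 0 ≤ (Aᵀ * A).trace := by
  have := (posSemidef_conjTranspose_mul_self A).trace_nonneg
  rwa [conjTranspose_eq_transpose_of_trivial] at this

theorem trace_transpose_mul_self_eq_zero {A : Matrix n n ℝ} (h : (Aᵀ * A).trace = 0) : A = 0 := by
  rw [← conjTranspose_eq_transpose_of_trivial] at h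
  exact trace_conjTranspose_mul_self_eq_zero_iff.1 h

variable [DecidableEq n]

theorem one_le_trace_of_isIdempotentElem {E : Matrix n n ℝ} (hE : E * E = E) (h0 : E ≠ 0) :
    1 ≤ E.trace := by
  have he : IsIdempotentElem (Matrix.toLin' E) := by
    rw [IsIdempotentElem, Module.End.mul_eq_comp, ← Matrix.toLin'_mul, hE]
  have ht := (LinearMap.IsIdempotentElem.isProj_range _ he).trace
  rw [Matrix.trace_toLin'_eq] at ht
  have hne : E.trace ≠ 0 := fun h => h0 <| by
    rw [← Matrix.trace_toLin'_eq] at h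
    exact Matrix.toLin'.map_eq_zero_iff.1 (LinearMap.IsIdempotentElem.eq_zero_of_trace_eq_zero he h)
  rw [ht] at hne ⊢
  exact_mod_cast Nat.one_le_iff_ne_zero.2 (by exact_mod_cast hne)

/-- The positive part of a polar decomposition can be inverted by a symmetric matrix `K` in the
bicommutant of `Yᵀ * Y`, so that `Y * K` is a nonzero partial isometry. -/
theorem exists_mul_partialIsometry {Y : Matrix n n ℝ} (hY : Y ≠ 0) :
    ∃ K : Matrix n n ℝ, Kᵀ = K ∧ (∀ a, Commute (Yᵀ * Y) a → Commute K a) ∧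
      Y * K * (Y * K)ᵀ * (Y * K) = Y * K ∧ Y * K ≠ 0 := by
  set H := Yᵀ * Y with hH
  have hpsd : H.PosSemidef := by
    simpa [conjTranspose_eq_transpose_of_trivial] using posSemidef_conjTranspose_mul_self Y
  have hsa : IsSelfAdjoint H := hpsd.1
  have hspec : ∀ x ∈ spectrum ℝ H, 0 ≤ x :=
    (posSemidef_iff_isHermitian_and_spectrum_nonneg.1 hpsd).2
  have hcont : ∀ g : ℝ → ℝ, ContinuousOn g (spectrum ℝ H) := fun g =>
    H.finite_real_spectrum.continuousOn g
  let f : ℝ → ℝ := fun x => (√x)⁻¹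
  have hid : cfc (fun x : ℝ => x) H = H := cfc_id' ℝ H
  have hK : (cfc f H)ᵀ = cfc f H := by
    rw [← conjTranspose_eq_transpose_of_trivial]
    exact (cfc_predicate f H : IsSelfAdjoint (cfc f H))
  have hsq : ∀ x ∈ spectrum ℝ H, f x * f x * x * f x = f x := fun x hx => by
    have h := Real.mul_self_sqrt (hspec x hx)
    simp only [f]
    rcases eq_or_ne (√x) 0 with h0 | h0
    · simp [h0]
    · nth_rewrite 3 [← h]
      field_simp
  have hsq' : ∀ x ∈ spectrum ℝ H, x * f x * f x * x = x := fun x hx => by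
    have h := Real.mul_self_sqrt (hspec x hx)
    simp only [f]
    rcases eq_or_ne (√x) 0 with h0 | h0
    · rw [← h]; simp [h0]
    · nth_rewrite 1 [← h]
      field_simp
  have h1 : cfc f H * cfc f H * H * cfc f H = cfc f H := by
    have : cfc f H * cfc f H * cfc (fun x : ℝ => x) H * cfc f H = cfc f H := by
      rw [← cfc_mul _ _ H (hcont _) (hcont _), ← cfc_mul _ _ H (hcont _) (hcont _),
        ← cfc_mul _ _ H (hcont _) (hcont _)]
      exact cfc_congr hsq
    rwa [hid] at this
  have h2 : H * cfc f H * cfc f H * H = H := by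
    have : cfc (fun x : ℝ => x) H * cfc f H * cfc f H * cfc (fun x : ℝ => x) H =
        cfc (fun x : ℝ => x) H := by
      rw [← cfc_mul _ _ H (hcont _) (hcont _), ← cfc_mul _ _ H (hcont _) (hcont _),
        ← cfc_mul _ _ H (hcont _) (hcont _)]
      exact cfc_congr hsq'
    rwa [hid] at this
  refine ⟨cfc f H, hK, fun a ha => Commute.cfc_real ha f, ?_, fun h => hY ?_⟩
  · calc Y * cfc f H * (Y * cfc f H)ᵀ * (Y * cfc f H)
        = Y * (cfc f H * cfc f H * (Yᵀ * Y) * cfc f H) := by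
          rw [transpose_mul, hK]; simp only [mul_assoc]
      _ = Y * cfc f H := by rw [← hH, h1]
  · have : H = 0 := by
      rw [← h2, hH, mul_assoc Yᵀ Y, h]; simp
    exact trace_transpose_mul_self_eq_zero (by rw [← hH, this, trace_zero])

variable (S : Subalgebra ℝ (Matrix n n ℝ × Matrix n n ℝ))

/-- Casimir averaging: isotypic pieces with equal nonzero characters admit a nonzero
intertwiner. -/
theorem exists_intertwiner_of_trace_eq (htr : ∀ x ∈ S, x.1.trace = x.2.trace)
    (hT : ∀ x ∈ S, (x.1ᵀ, x.2ᵀ) ∈ S) {P Q : Matrix n n ℝ} (hPT : Pᵀ = P) (hP : P ≠ 0)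
    (hPP : P * P = P) (hQQ : Q * Q = Q)
    (hPc : ∀ x ∈ S, Commute P x.1) (hQc : ∀ x ∈ S, Commute Q x.2)
    (hPQ : ∀ x ∈ S, (P * x.1).trace = (Q * x.2).trace) :
    ∃ Y : Matrix n n ℝ, Y ≠ 0 ∧ Q * Y = Y ∧ Y * P = Y ∧ ∀ x ∈ S, Y * x.1 = x.2 * Y := by
  let B : S →ₗ[ℝ] S →ₗ[ℝ] ℝ := LinearMap.mk₂ ℝ (fun x y => ((x.1.1)ᵀ * y.1.1).trace)
    (by intros; simp [add_mul]) (by intros; simp) (by intros; simp [mul_add]) (by intros; simp)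
  have hB : ∀ x y, B x y = ((x.1.1)ᵀ * y.1.1).trace := fun _ _ => rfl
  obtain ⟨d, e, he⟩ := exists_frame_of_posDef B
    (fun x y => by rw [hB, hB, ← trace_transpose, transpose_mul, transpose_transpose])
    (fun x => trace_transpose_mul_self_nonneg _)
    (fun x hx => by
      have h1 : x.1.1 = 0 := trace_transpose_mul_self_eq_zero hx
      have h2 : x.1.2 = 0 := trace_transpose_mul_self_eq_zero <| by
        have := htr _ (S.mul_mem (hT _ x.2) x.2)
        simpa [h1] using this.symm
      exact Subtype.ext (Prod.ext h1 h2))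
  let Y : Matrix n n ℝ → Matrix n n ℝ := fun M =>
    ∑ k, Q * (e k).1.2 * M * ((e k).1.1)ᵀ * P
  have he1 : ∀ v : S, v.1.1 = ∑ k, B (e k) v • (e k).1.1 := fun v => by
    conv_lhs => rw [he v]
    simp [Prod.fst_sum]
  have he2 : ∀ v : S, v.1.2 = ∑ k, B (e k) v • (e k).1.2 := fun v => by
    conv_lhs => rw [he v]
    simp [Prod.snd_sum]
  have hint : ∀ M, ∀ x ∈ S, Y M * x.1 = x.2 * Y M := fun M x hx => by
    let X : S := ⟨x, hx⟩
    let X' : S := ⟨(x.1ᵀ, x.2ᵀ), hT x hx⟩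
    have hl : ∀ k, x.2 * (Q * (e k).1.2 * M * ((e k).1.1)ᵀ * P) =
        ∑ j, B (e j) (X * e k) • (Q * (e j).1.2 * M * ((e k).1.1)ᵀ * P) := fun k => by
      have : x.2 * (Q * (e k).1.2 * M * ((e k).1.1)ᵀ * P) =
          Q * (X * e k).1.2 * M * ((e k).1.1)ᵀ * P := by
        simp only [← mul_assoc, ← (hQc x hx).eq, X, MulMemClass.coe_mul, Prod.snd_mul]
      rw [this, he2 (X * e k)]
      simp [Finset.mul_sum, Finset.sum_mul]
    have hr : ∀ j, Q * (e j).1.2 * M * ((e j).1.1)ᵀ * P * x.1 =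
        ∑ k, B (e k) (X' * e j) • (Q * (e j).1.2 * M * ((e k).1.1)ᵀ * P) := fun j => by
      have : Q * (e j).1.2 * M * ((e j).1.1)ᵀ * P * x.1 =
          Q * (e j).1.2 * M * ((X' * e j).1.1)ᵀ * P := by
        simp only [X', MulMemClass.coe_mul, Prod.fst_mul, transpose_mul, transpose_transpose,
          mul_assoc, (hPc x hx).eq]
      rw [this, he1 (X' * e j), transpose_sum]
      simp [Finset.mul_sum, Finset.sum_mul]
    simp only [Y]
    rw [Finset.sum_mul, Finset.mul_sum, Finset.sum_congr rfl fun j _ => hr j,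
      Finset.sum_congr rfl fun k _ => hl k, Finset.sum_comm]
    refine Finset.sum_congr rfl fun k _ => Finset.sum_congr rfl fun j _ => ?_
    congr 1
    rw [hB, hB, ← trace_transpose]
    simp [X, X', transpose_mul, mul_assoc]
  by_contra! hcon
  have hzero : ∀ M, Y M = 0 := fun M => by
    by_contra h
    obtain ⟨x, hx, hne⟩ := hcon (Y M) h
      (by simp only [Y, Finset.mul_sum, ← mul_assoc, hQQ])
      (by simp only [Y, Finset.sum_mul, mul_assoc, hPP])
    exact hne (hint M x hx)
  have hsum : ∑ k, (Q * (e k).1.2).trace * (((e k).1.1)ᵀ * P).trace = 0 := by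
    simp only [trace, diag_apply, Finset.sum_mul_sum]
    rw [Finset.sum_comm]
    refine Finset.sum_eq_zero fun i _ => ?_
    rw [Finset.sum_comm]
    refine Finset.sum_eq_zero fun j _ => ?_
    have h := congrFun₂ (hzero (single i j 1)) i j
    simp only [Y, Matrix.sum_apply, Matrix.zero_apply] at h
    refine Eq.trans ?_ h
    refine Finset.sum_congr rfl fun k _ => ?_
    rw [mul_assoc _ _ P, Matrix.mul_apply]
    simp [Matrix.mul_apply, single_apply, Finset.sum_ite_eq, ite_and]
  have hk : ∀ k, (P * (e k).1.1).trace = 0 := fun k => by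
    have h : ∀ k, (Q * (e k).1.2).trace * (((e k).1.1)ᵀ * P).trace =
        (P * (e k).1.1).trace * (P * (e k).1.1).trace := fun k => by
      rw [← hPQ _ (e k).2, ← trace_transpose (((e k).1.1)ᵀ * P), transpose_mul,
        transpose_transpose, hPT]
    rw [Finset.sum_congr rfl fun k _ => h k,
      Finset.sum_eq_zero_iff_of_nonneg fun k _ => mul_self_nonneg _] at hsum
    exact mul_self_eq_zero.1 (hsum k (Finset.mem_univ k))
  have : P.trace = 0 := by
    have : P.trace = (P * (1 : S).1.1).trace := by simp
    rw [this, he1 1]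
    simp [Finset.mul_sum, trace_sum, hk]
  have := one_le_trace_of_isIdempotentElem hPP hP
  linarith

theorem exists_orthogonal_intertwiner (htr : ∀ x ∈ S, x.1.trace = x.2.trace)
    (hT : ∀ x ∈ S, (x.1ᵀ, x.2ᵀ) ∈ S) :
    ∃ U : Matrix n n ℝ, Uᵀ * U = 1 ∧ ∀ x ∈ S, U * x.1 = x.2 * U := by
  have hadj : ∀ U : Matrix n n ℝ, (∀ x ∈ S, U * x.1 = x.2 * U) →
      ∀ x ∈ S, Uᵀ * x.2 = x.1 * Uᵀ := fun U hU x hx => by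
    have := congrArg transpose (hU _ (hT x hx))
    simpa [transpose_mul] using this.symm
  by_contra! hcon
  have key : ∀ m : ℕ, ∃ U : Matrix n n ℝ, U * Uᵀ * U = U ∧
      (∀ x ∈ S, U * x.1 = x.2 * U) ∧ (m : ℝ) ≤ (Uᵀ * U).trace := by
    intro m
    induction m with
    | zero => exact ⟨0, by simp⟩
    | succ m ih =>
      obtain ⟨U, hU, hUS, hm⟩ := ih
      have hU' := hadj U hUS
      have hUT : Uᵀ * U * Uᵀ = Uᵀ := by simpa [transpose_mul, mul_assoc] using congrArg transpose hU
      have hc1 : ∀ x ∈ S, Commute (Uᵀ * U) x.1 := fun x hx => by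
        rw [Commute, SemiconjBy, mul_assoc, hUS x hx, ← mul_assoc, hU' x hx, mul_assoc]
      have hc2 : ∀ x ∈ S, Commute (U * Uᵀ) x.2 := fun x hx => by
        rw [Commute, SemiconjBy, mul_assoc, hU' x hx, ← mul_assoc, hUS x hx, mul_assoc]
      obtain ⟨Y, hY0, hQY, hYP, hYS⟩ := exists_intertwiner_of_trace_eq S htr hT
        (P := 1 - Uᵀ * U) (Q := 1 - U * Uᵀ) (by simp [transpose_mul])
        (fun h => by
          obtain ⟨x, hx, hne⟩ := hcon U (sub_eq_zero.1 h).symm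
          exact hne (hUS x hx))
        (IsIdempotentElem.one_sub (by rw [IsIdempotentElem, ← mul_assoc, hUT]))
        (IsIdempotentElem.one_sub (by rw [IsIdempotentElem, ← mul_assoc, hU]))
        (fun x hx => (Commute.one_left _).sub_left (hc1 x hx))
        (fun x hx => (Commute.one_left _).sub_left (hc2 x hx))
        (fun x hx => by
          rw [sub_mul, sub_mul, trace_sub, trace_sub, one_mul, one_mul, htr x hx, mul_assoc,
            hUS x hx, trace_mul_comm, mul_assoc, trace_mul_comm x.2])
      obtain ⟨K, hK, hKc, hZ, hZ0⟩ := exists_mul_partialIsometry hY0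
      have hY' := hadj Y hYS
      have hYc : ∀ x ∈ S, Commute K x.1 := fun x hx => hKc _ <| by
        rw [Commute, SemiconjBy, mul_assoc, hYS x hx, ← mul_assoc, hY' x hx, mul_assoc]
      have hKP : Commute K (Uᵀ * U) := hKc _ <| by
        have h1 : Y * (Uᵀ * U) = 0 := by simpa [mul_sub] using hYP
        have h2 : Uᵀ * U * Yᵀ = 0 := by simpa [transpose_mul, mul_assoc] using congrArg transpose h1
        rw [Commute, SemiconjBy, mul_assoc, h1, ← mul_assoc, h2]; simp
      set Z := Y * K with hZdef
      have hZU : Z * Uᵀ = 0 := by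
        have h1 : Y * (Uᵀ * U) = 0 := by simpa [mul_sub] using hYP
        rw [hZdef, ← hUT, ← mul_assoc, mul_assoc Y K, hKP.eq, ← mul_assoc Y, h1]; simp
      have hUZ : Uᵀ * Z = 0 := by
        have h1 : U * Uᵀ * Y = 0 := by simpa [sub_mul] using hQY
        rw [hZdef, ← hUT, mul_assoc Uᵀ, mul_assoc Uᵀ, ← mul_assoc _ Y, h1]; simp
      have hUZ' : U * Zᵀ = 0 := by simpa [transpose_mul] using congrArg transpose hZU
      have hZU' : Zᵀ * U = 0 := by simpa [transpose_mul] using congrArg transpose hUZ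
      refine ⟨U + Z, ?_, fun x hx => ?_, ?_⟩
      · rw [transpose_add, add_mul U, mul_add U, mul_add Z, hUZ', hZU, add_zero, zero_add, add_mul,
          mul_add, mul_add, hU, hZ, mul_assoc U, hUZ, mul_assoc Z Zᵀ U, hZU']
        simp
      · rw [add_mul, mul_add, hUS x hx, hZdef, mul_assoc Y, (hYc x hx).eq, ← mul_assoc, hYS x hx,
          mul_assoc]
      · have h1 : 1 ≤ (Zᵀ * Z).trace := one_le_trace_of_isIdempotentElem
          (by rw [mul_assoc, ← mul_assoc Z, hZ])
          (fun h => hZ0 (trace_transpose_mul_self_eq_zero (by rw [h, trace_zero])))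
        simp only [transpose_add, add_mul, mul_add, hUZ, hZU', trace_add, trace_zero]
        push_cast
        linarith
  obtain ⟨U, hU, -, hle⟩ := key (Fintype.card n + 1)
  have hUT : Uᵀ * U * Uᵀ = Uᵀ := by simpa [transpose_mul, mul_assoc] using congrArg transpose hU
  have h := trace_transpose_mul_self_nonneg (1 - Uᵀ * U)
  have : (1 - Uᵀ * U)ᵀ * (1 - Uᵀ * U) = 1 - Uᵀ * U := by
    rw [transpose_sub, transpose_one, transpose_mul, transpose_transpose]
    exact IsIdempotentElem.one_sub (by rw [IsIdempotentElem, ← mul_assoc, hUT])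
  rw [this, trace_sub, trace_one] at h
  push_cast at hle
  linarith

end TraceForm

section Words

variable {q : ℕ} {ι : Type*}

theorem decoratedWordProd_nil (F : ι → Matrix (Fin q) (Fin q) ℂ) : decoratedWordProd F [] = 1 := rfl

theorem decoratedWordProd_cons (F : ι → Matrix (Fin q) (Fin q) ℂ) (p : ι × Bool)
    (w : List (ι × Bool)) :
    decoratedWordProd F (p :: w) =
      (if p.2 then (F p.1)ᵀ else F p.1) * decoratedWordProd F w := by
  simp [decoratedWordProd]

/-- The algebra of simultaneous evaluations in `F` and `G` of transpose-decorated polynomials. -/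
noncomputable def decoratedAlgebra (F G : ι → Matrix (Fin q) (Fin q) ℂ) :
    Subalgebra ℂ (Matrix (Fin q) (Fin q) ℂ × Matrix (Fin q) (Fin q) ℂ) :=
  Algebra.adjoin ℂ {x | ∃ i, x = (F i, G i) ∨ x = ((F i)ᵀ, (G i)ᵀ)}

variable {F G : ι → Matrix (Fin q) (Fin q) ℂ}

theorem mk_mem_decoratedAlgebra (i : ι) : (F i, G i) ∈ decoratedAlgebra F G :=
  Algebra.subset_adjoin ⟨i, Or.inl rfl⟩

theorem mk_transpose_mem_decoratedAlgebra (i : ι) :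
    ((F i)ᵀ, (G i)ᵀ) ∈ decoratedAlgebra F G :=
  Algebra.subset_adjoin ⟨i, Or.inr rfl⟩

theorem trace_eq_of_mem_decoratedAlgebra
    (h : ∀ w : List (ι × Bool), (decoratedWordProd F w).trace = (decoratedWordProd G w).trace)
    {x : Matrix (Fin q) (Fin q) ℂ × Matrix (Fin q) (Fin q) ℂ} (hx : x ∈ decoratedAlgebra F G) :
    x.1.trace = x.2.trace := by
  rw [decoratedAlgebra, ← Subalgebra.mem_toSubmodule, Algebra.adjoin_eq_span] at hx
  induction hx using Submodule.span_induction with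
  | mem x hx =>
    obtain ⟨w, hw⟩ : ∃ w, x = (decoratedWordProd F w, decoratedWordProd G w) := by
      induction hx using Submonoid.closure_induction_left with
      | one => exact ⟨[], rfl⟩
      | mul_left x hx y _ ih =>
        obtain ⟨w, rfl⟩ := ih
        obtain ⟨i, rfl | rfl⟩ := hx
        · exact ⟨(i, false) :: w, by simp [decoratedWordProd_cons]⟩
        · exact ⟨(i, true) :: w, by simp [decoratedWordProd_cons]⟩
    rw [hw]
    exact h w
  | zero => simp
  | add x y _ _ hx hy => simp [hx, hy]
  | smul a x _ hx => simp [hx]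

theorem transpose_mem_decoratedAlgebra
    {x : Matrix (Fin q) (Fin q) ℂ × Matrix (Fin q) (Fin q) ℂ} (hx : x ∈ decoratedAlgebra F G) :
    (x.1ᵀ, x.2ᵀ) ∈ decoratedAlgebra F G := by
  induction hx using Algebra.adjoin_induction with
  | mem x hx =>
    obtain ⟨i, rfl | rfl⟩ := hx
    · exact mk_transpose_mem_decoratedAlgebra i
    · simpa using mk_mem_decoratedAlgebra i
  | algebraMap r =>
    convert (decoratedAlgebra F G).algebraMap_mem r using 1
    simp [Prod.ext_iff, Algebra.algebraMap_eq_smul_one]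
  | add x y _ _ hx hy => simpa using add_mem hx hy
  | mul x y _ _ hx hy => simpa using mul_mem hy hx

/-- The real points of `decoratedAlgebra F G`. -/
noncomputable def realDecoratedAlgebra (F G : ι → Matrix (Fin q) (Fin q) ℂ) :
    Subalgebra ℝ (Matrix (Fin q) (Fin q) ℝ × Matrix (Fin q) (Fin q) ℝ) :=
  ((decoratedAlgebra F G).restrictScalars ℝ).comap
    (Complex.ofRealAm.mapMatrix.prodMap Complex.ofRealAm.mapMatrix)

theorem mem_realDecoratedAlgebra {x : Matrix (Fin q) (Fin q) ℝ × Matrix (Fin q) (Fin q) ℝ} :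
    x ∈ realDecoratedAlgebra F G ↔
      (x.1.map Complex.ofReal, x.2.map Complex.ofReal) ∈ decoratedAlgebra F G :=
  Iff.rfl

theorem map_re_mem_realDecoratedAlgebra
    {x : Matrix (Fin q) (Fin q) ℂ × Matrix (Fin q) (Fin q) ℂ} (hx : x ∈ decoratedAlgebra F G)
    (hx' : (x.1.map (starRingEnd ℂ), x.2.map (starRingEnd ℂ)) ∈ decoratedAlgebra F G) :
    (x.1.map Complex.re, x.2.map Complex.re) ∈ realDecoratedAlgebra F G := by
  rw [mem_realDecoratedAlgebra]
  convert (decoratedAlgebra F G).smul_mem (add_mem hx hx') (2⁻¹ : ℂ) using 1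
  ext <;> simp [← mul_add, Complex.add_conj]

theorem map_im_mem_realDecoratedAlgebra
    {x : Matrix (Fin q) (Fin q) ℂ × Matrix (Fin q) (Fin q) ℂ} (hx : x ∈ decoratedAlgebra F G)
    (hx' : (x.1.map (starRingEnd ℂ), x.2.map (starRingEnd ℂ)) ∈ decoratedAlgebra F G) :
    (x.1.map Complex.im, x.2.map Complex.im) ∈ realDecoratedAlgebra F G := by
  rw [mem_realDecoratedAlgebra]
  convert (decoratedAlgebra F G).smul_mem (sub_mem hx hx') ((2 * Complex.I)⁻¹ : ℂ) using 1
  ext <;> simp [Complex.sub_conj] <;> field_simp <;> simp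

theorem map_ofReal_re_add_im (A : Matrix (Fin q) (Fin q) ℂ) :
    (A.map Complex.re).map Complex.ofReal + Complex.I • (A.map Complex.im).map Complex.ofReal =
      A := by
  ext i j
  simp [mul_comm Complex.I, Complex.re_add_im]

theorem decoratedWordProd_conj {T : Matrix (Fin q) (Fin q) ℂ} (hT : T * Tᵀ = 1)
    (hFG : ∀ i, T * F i * Tᵀ = G i) (w : List (ι × Bool)) :
    decoratedWordProd G w = T * decoratedWordProd F w * Tᵀ := by
  have hT' : Tᵀ * T = 1 := mul_eq_one_comm.1 hT
  induction w with
  | nil => simp [decoratedWordProd_nil, hT]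
  | cons p w ih =>
    have hp : (if p.2 then (G p.1)ᵀ else G p.1) =
        T * (if p.2 then (F p.1)ᵀ else F p.1) * Tᵀ := by
      split_ifs
      · rw [← hFG]; simp [transpose_mul, mul_assoc]
      · exact (hFG _).symm
    rw [decoratedWordProd_cons, decoratedWordProd_cons, ih, hp]
    simp only [mul_assoc]
    rw [← mul_assoc Tᵀ T, hT', one_mul]

end Words

/-- Instance of Corollary cor:complex for families of binary signatures:
conjugate-closed families are Holant-indistinguishable (equal traces of all
transpose-decorated words) iff they are related by a complex orthogonal
holographic transformation. -/
theorem stmt16 {q : ℕ} (hq : 0 < q) {ι : Type*}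
    (F G : ι → Matrix (Fin q) (Fin q) ℂ)
    (c : ι → ι) (hc : c ∘ c = id)
    (hFc : ∀ i : ι, F (c i) = (F i).map (starRingEnd ℂ))
    (hGc : ∀ i : ι, G (c i) = (G i).map (starRingEnd ℂ)) :
    (∀ w : List (ι × Bool),
        Matrix.trace (decoratedWordProd F w) = Matrix.trace (decoratedWordProd G w)) ↔
    ∃ T : Matrix (Fin q) (Fin q) ℂ, T * Tᵀ = 1 ∧ ∀ i : ι, T * F i * Tᵀ = G i := by
  constructor
  · intro h
    obtain ⟨U, hU, hUS⟩ := exists_orthogonal_intertwiner (realDecoratedAlgebra F G)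
      (fun x hx => by
        have := trace_eq_of_mem_decoratedAlgebra h (mem_realDecoratedAlgebra.1 hx)
        simp only [trace, diag_apply, map_apply] at this ⊢
        exact_mod_cast this)
      (fun x hx => by
        rw [mem_realDecoratedAlgebra] at hx ⊢
        simpa [transpose_map] using transpose_mem_decoratedAlgebra hx)
    have hUC : (U.map Complex.ofReal)ᵀ * U.map Complex.ofReal = 1 := by
      have := congrArg Complex.ofRealHom.mapMatrix hU
      rwa [map_mul, map_one] at this
    have hmap : ∀ A B : Matrix (Fin q) (Fin q) ℝ, U * A = B * U →
        U.map Complex.ofReal * A.map Complex.ofReal =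
          B.map Complex.ofReal * U.map Complex.ofReal := fun A B hAB => by
      have := congrArg Complex.ofRealHom.mapMatrix hAB
      rwa [map_mul, map_mul] at this
    refine ⟨U.map Complex.ofReal, mul_eq_one_comm.1 hUC, fun i => ?_⟩
    have hi : (F i, G i) ∈ decoratedAlgebra F G := mk_mem_decoratedAlgebra i
    have hi' : ((F i).map (starRingEnd ℂ), (G i).map (starRingEnd ℂ)) ∈ decoratedAlgebra F G := by
      rw [← hFc, ← hGc]
      exact mk_mem_decoratedAlgebra (c i)
    have hre := hmap _ _ (hUS _ (map_re_mem_realDecoratedAlgebra hi hi'))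
    have him := hmap _ _ (hUS _ (map_im_mem_realDecoratedAlgebra hi hi'))
    have hUF : U.map Complex.ofReal * F i = G i * U.map Complex.ofReal := by
      rw [← map_ofReal_re_add_im (F i), ← map_ofReal_re_add_im (G i), mul_add, add_mul,
        Matrix.mul_smul, Matrix.smul_mul, hre, him]
    rw [hUF, mul_assoc, mul_eq_one_comm.1 hUC, mul_one]
  · rintro ⟨T, hT, hFG⟩ w
    rw [decoratedWordProd_conj hT hFG, trace_mul_comm, ← mul_assoc, mul_eq_one_comm.1 hT, one_mul]
end
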